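/- arXiv:1206.3152 — 2 statements merged into one kernel-verified Lean document; each statement's English description precedes it below -/
import Mathlib

section
/- There exist constants c > 0 and d₀ such that for all integers d ≥ d₀, | |F_3| − 2·2^{2^{d−1}} | ≤ e^{−cd}·2^{2^{d−1}}. -/
/-- Two vertices of the Hamming cube `{0,1}^d` are adjacent iff they differ in
exactly one coordinate. -/
def cubeAdj (d : ℕ) (u v : Fin d → Bool) : Prop :=
  (Finset.univ.filter fun i => u i ≠ v i).card = 1


/-- The set of homomorphisms from `Q_d` to `ℤ` sending the all-zeros vertex to `0`. -/
def HomF (d : ℕ) : Set ((Fin d → Bool) → ℤ) :=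
  {f | f (fun _ => false) = 0 ∧ ∀ u v, cubeAdj d u v → |f u - f v| = 1}

/-- Those homomorphisms whose range (image) has exactly `i` elements. -/
def HomFi (d i : ℕ) : Set ((Fin d → Bool) → ℤ) :=
  {f ∈ HomF d | (Set.range f).ncard = i}

namespace HammingCube

open Finset

/-- The vertex obtained from `u` by changing coordinate `i`. -/
def flip {d : ℕ} (u : Fin d → Bool) (i : Fin d) : Fin d → Bool :=
  Function.update u i (!u i)

/-- The number of coordinates equal to `1`. -/
def weight {d : ℕ} (u : Fin d → Bool) : ℕ := ∑ i, (u i).toNat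

theorem flip_flip {d : ℕ} (u : Fin d → Bool) (i : Fin d) : flip (flip u i) i = u := by
  simp [flip]

theorem cubeAdj_flip {d : ℕ} (u : Fin d → Bool) (i : Fin d) : cubeAdj d u (flip u i) := by
  rw [cubeAdj, card_eq_one]
  refine ⟨i, ?_⟩
  ext j
  rw [mem_filter, mem_singleton]
  by_cases h : j = i
  · subst h; simp [flip]
  · simp [flip, h]

theorem exists_eq_flip {d : ℕ} {u v : Fin d → Bool} (h : cubeAdj d u v) :
    ∃ i, v = flip u i := by
  obtain ⟨i, hi⟩ := card_eq_one.1 h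
  refine ⟨i, ?_⟩
  ext1 j
  have hj : u j ≠ v j ↔ j = i := by
    simpa using congrArg (fun s => j ∈ s) hi
  by_cases h : j = i
  · subst h
    have := hj.2 rfl
    simp only [flip, Function.update_self]
    revert this
    cases u j <;> cases v j <;> simp
  · simp only [flip, Function.update_of_ne h]
    by_contra hne
    exact h (hj.1 (Ne.symm hne))

theorem weight_flip {d : ℕ} (u : Fin d → Bool) (i : Fin d) :
    weight (flip u i) + (u i).toNat = weight u + (!u i).toNat := by
  have h : ∑ j ∈ univ.erase i, (flip u i j).toNat = ∑ j ∈ univ.erase i, (u j).toNat :=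
    sum_congr rfl fun j hj => by simp [flip, Function.update_of_ne (ne_of_mem_erase hj)]
  have h1 := add_sum_erase univ (fun j => (u j).toNat) (mem_univ i)
  have h2 := add_sum_erase univ (fun j => (flip u i j).toNat) (mem_univ i)
  have h3 : flip u i i = !u i := by simp [flip]
  simp only [h3, h] at h2
  unfold weight
  omega

theorem odd_weight_flip {d : ℕ} (u : Fin d → Bool) (i : Fin d) :
    Odd (weight (flip u i)) ↔ ¬ Odd (weight u) := by
  have h := weight_flip u i
  rw [Nat.odd_iff, Nat.odd_iff]
  cases hu : u i <;> simp [hu] at h <;> omega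

theorem weight_zero {d : ℕ} : weight (fun _ : Fin d => false) = 0 := by simp [weight]

/-- Induction on vertices: every vertex is reached from the origin by flipping coordinates. -/
theorem flip_induction {d : ℕ} {P : (Fin d → Bool) → Prop} (h0 : P fun _ => false)
    (hs : ∀ u i, P u → P (flip u i)) (v : Fin d → Bool) : P v := by
  induction hn : weight v generalizing v with
  | zero =>
    have : v = fun _ => false := by
      ext1 i
      have := (sum_eq_zero_iff.1 hn) i (mem_univ i)
      simpa using this
    exact this ▸ h0
  | succ n ih =>
    obtain ⟨i, hi⟩ : ∃ i, v i = true := by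
      by_contra! hne
      have : v = fun _ => false := by ext1 i; simpa using hne i
      rw [this, weight_zero] at hn
      omega
    have h := weight_flip v i
    simp only [hi, Bool.toNat_true, Bool.not_true, Bool.toNat_false] at h
    rw [← flip_flip v i]
    exact hs _ _ (ih _ (by omega))

theorem card_odd (n : ℕ) : #{v : Fin (n + 1) → Bool | Odd (weight v)} = 2 ^ n ∧
    #{v : Fin (n + 1) → Bool | ¬ Odd (weight v)} = 2 ^ n := by
  have h1 := card_filter_add_card_filter_not (s := (univ : Finset (Fin (n + 1) → Bool)))
    (fun v => Odd (weight v))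
  have h2 : #{v : Fin (n + 1) → Bool | Odd (weight v)} =
      #{v : Fin (n + 1) → Bool | ¬ Odd (weight v)} := by
    refine card_bij' (fun v _ => flip v 0) (fun v _ => flip v 0) ?_ ?_ ?_ ?_
    · intro v hv; simpa [odd_weight_flip, -Nat.not_odd_iff_even] using hv
    · intro v hv; simpa [odd_weight_flip, -Nat.not_odd_iff_even] using hv
    · intro v _; exact flip_flip v 0
    · intro v _; exact flip_flip v 0
  have h3 : #(univ : Finset (Fin (n + 1) → Bool)) = 2 ^ n * 2 := by
    simp [pow_succ]
  omega

section Homomorphisms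

variable {d : ℕ} {f : (Fin d → Bool) → ℤ}

theorem mem_HomF_iff : f ∈ HomF d ↔
    f (fun _ => false) = 0 ∧ ∀ u i, |f u - f (flip u i)| = 1 := by
  refine and_congr_right fun _ => ⟨fun h u i => h _ _ (cubeAdj_flip u i), fun h u v huv => ?_⟩
  obtain ⟨i, rfl⟩ := exists_eq_flip huv
  exact h u i

theorem odd_apply_iff (hf : f ∈ HomF d) (v : Fin d → Bool) : Odd (f v) ↔ Odd (weight v) := by
  rw [mem_HomF_iff] at hf
  induction v using flip_induction with
  | h0 => simp [hf.1, weight_zero]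
  | hs u i ih =>
    rw [odd_weight_flip, ← ih, Int.odd_iff, Int.odd_iff]
    have := hf.2 u i
    rw [abs_eq zero_le_one] at this
    omega

theorem mem_range_of_between (hf : f ∈ HomF d) (v : Fin d → Bool) :
    ∀ k, (0 ≤ k ∧ k ≤ f v) ∨ (f v ≤ k ∧ k ≤ 0) → k ∈ Set.range f := by
  rw [mem_HomF_iff] at hf
  induction v using flip_induction with
  | h0 => intro k hk; rw [hf.1] at hk; exact ⟨_, hf.1.trans (by omega)⟩
  | hs u i ih =>
    intro k hk
    by_cases h : k = f (flip u i)
    · exact ⟨_, h.symm⟩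
    · have := hf.2 u i
      rw [abs_eq zero_le_one] at this
      by_cases h0 : k = 0
      · exact ⟨_, hf.1.trans h0.symm⟩
      · exact ih k (by omega)

end Homomorphisms

/-- Functions that vanish on even vertices and take the values `1`, `-1` on odd ones. -/
def zeroOnEven (d : ℕ) : Finset ((Fin d → Bool) → ℤ) :=
  Fintype.piFinset fun v => if Odd (weight v) then {1, -1} else {0}

/-- Functions that equal `e` on odd vertices, take the values `0`, `2 * e` on even ones, and
vanish at the origin. -/
def constOnOdd (d : ℕ) (e : ℤ) : Finset ((Fin d → Bool) → ℤ) :=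
  Fintype.piFinset fun v =>
    if Odd (weight v) then {e} else if v = fun _ => false then {0} else {0, 2 * e}

/-- The function equal to `e` on odd vertices and `0` on even ones. -/
def twoValued (d : ℕ) (e : ℤ) (v : Fin d → Bool) : ℤ := if Odd (weight v) then e else 0

theorem card_zeroOnEven (n : ℕ) : #(zeroOnEven (n + 1)) = 2 ^ 2 ^ n := by
  rw [zeroOnEven, Fintype.card_piFinset]
  have : ∀ v : Fin (n + 1) → Bool,
      #(if Odd (weight v) then ({1, -1} : Finset ℤ) else {0}) =
        if Odd (weight v) then 2 else 1 := by
    intro v; split_ifs <;> rfl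
  simp only [this]
  rw [prod_ite, prod_const_one, prod_const, (card_odd n).1, mul_one]

theorem two_mul_card_constOnOdd (n : ℕ) {e : ℤ} (he : e ≠ 0) :
    2 * #(constOnOdd (n + 1) e) = 2 ^ 2 ^ n := by
  rw [constOnOdd, Fintype.card_piFinset, ← mul_prod_erase univ _ (mem_univ fun _ => false)]
  have h0 : ¬ Odd (weight fun _ : Fin (n + 1) => false) := by simp [weight_zero]
  have h1 : #({0, 2 * e} : Finset ℤ) = 2 := card_pair (by omega)
  have h2 : ∏ v ∈ univ.erase (fun _ : Fin (n + 1) => false),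
      #(if Odd (weight v) then ({e} : Finset ℤ) else
        if v = fun _ => false then {0} else {0, 2 * e}) =
      ∏ v ∈ univ.erase (fun _ : Fin (n + 1) => false), if Odd (weight v) then 1 else 2 := by
    refine prod_congr rfl fun v hv => ?_
    rw [if_neg (ne_of_mem_erase hv)]
    split_ifs
    · simp
    · exact h1
  have h3 := mul_prod_erase univ (fun v : Fin (n + 1) → Bool => if Odd (weight v) then 1 else 2)
    (mem_univ fun _ => false)
  simp only [if_neg h0] at h3
  rw [h2, if_neg h0, if_pos rfl, card_singleton, one_mul, h3, prod_ite, prod_const_one,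
    prod_const, (card_odd n).2, one_mul]

section Membership

variable {d : ℕ} {e : ℤ} {f : (Fin d → Bool) → ℤ}

theorem mem_zeroOnEven : f ∈ zeroOnEven d ↔
    ∀ v, (Odd (weight v) → f v = 1 ∨ f v = -1) ∧ (¬ Odd (weight v) → f v = 0) := by
  rw [zeroOnEven, Fintype.mem_piFinset]
  refine forall_congr' fun v => ?_
  split_ifs with h <;> simp [h, -Nat.not_odd_iff_even]

theorem mem_constOnOdd : f ∈ constOnOdd d e ↔ f (fun _ => false) = 0 ∧
    ∀ v, (Odd (weight v) → f v = e) ∧ (¬ Odd (weight v) → f v = 0 ∨ f v = 2 * e) := by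
  rw [constOnOdd, Fintype.mem_piFinset]
  constructor
  · intro h
    refine ⟨by simpa [weight_zero] using h fun _ => false, fun v => ?_⟩
    have := h v
    split_ifs at this <;> simp_all [-Nat.not_odd_iff_even]
  · rintro ⟨h0, h⟩ v
    have := h v
    split_ifs <;> simp_all [-Nat.not_odd_iff_even]

theorem zeroOnEven_subset_HomF (hf : f ∈ zeroOnEven d) : f ∈ HomF d := by
  rw [mem_zeroOnEven] at hf
  refine mem_HomF_iff.2 ⟨(hf _).2 (by simp [weight_zero]), fun u i => ?_⟩
  have h1 := hf u
  have h2 := hf (flip u i)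
  rw [odd_weight_flip] at h2
  rw [abs_eq zero_le_one]
  by_cases h : Odd (weight u)
  · have := h1.1 h
    have := h2.2 (not_not.2 h)
    omega
  · have := h1.2 h
    have := h2.1 h
    omega

theorem constOnOdd_subset_HomF (he : e = 1 ∨ e = -1) (hf : f ∈ constOnOdd d e) :
    f ∈ HomF d := by
  rw [mem_constOnOdd] at hf
  refine mem_HomF_iff.2 ⟨hf.1, fun u i => ?_⟩
  have h1 := hf.2 u
  have h2 := hf.2 (flip u i)
  rw [odd_weight_flip] at h2
  rw [abs_eq zero_le_one]
  by_cases h : Odd (weight u)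
  · have := h1.1 h
    have := h2.2 (not_not.2 h)
    omega
  · have := h1.2 h
    have := h2.1 h
    omega

theorem zeroOnEven_range (hf : f ∈ zeroOnEven d) (h1 : f ≠ twoValued d 1)
    (h2 : f ≠ twoValued d (-1)) : Set.range f = {-1, 0, 1} := by
  have h0 := (zeroOnEven_subset_HomF hf).1
  rw [mem_zeroOnEven] at hf
  have key : ∀ a b : ℤ, (∀ x, x = 1 ∨ x = -1 → x = a ∨ x = b) → f ≠ twoValued d a →
      ∃ v, f v = b := by
    intro a b hab hne
    by_contra! hb
    refine hne (funext fun v => ?_)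
    rw [twoValued]
    split_ifs with h
    · exact (hab _ ((hf v).1 h)).resolve_right (hb v)
    · exact (hf v).2 h
  apply Set.Subset.antisymm
  · rintro _ ⟨v, rfl⟩
    simp only [Set.mem_insert_iff, Set.mem_singleton_iff]
    by_cases h : Odd (weight v)
    · have := (hf v).1 h; omega
    · have := (hf v).2 h; omega
  · rintro x (rfl | rfl | rfl)
    · exact key 1 (-1) (by omega) h1
    · exact ⟨_, h0⟩
    · exact key (-1) 1 (by omega) h2

theorem constOnOdd_range {n : ℕ} {f : (Fin (n + 1) → Bool) → ℤ} (hf : f ∈ constOnOdd (n + 1) e)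
    (h1 : f ≠ twoValued (n + 1) e) : Set.range f = {0, e, 2 * e} := by
  rw [mem_constOnOdd] at hf
  apply Set.Subset.antisymm
  · rintro _ ⟨v, rfl⟩
    simp only [Set.mem_insert_iff, Set.mem_singleton_iff]
    by_cases h : Odd (weight v)
    · have := (hf.2 v).1 h; omega
    · have := (hf.2 v).2 h; omega
  · rintro x (rfl | rfl | rfl)
    · exact ⟨_, hf.1⟩
    · exact ⟨flip (fun _ => false) 0, (hf.2 _).1 (by simp [odd_weight_flip, weight_zero])⟩
    · by_contra hb
      refine h1 (funext fun v => ?_)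
      rw [twoValued]
      split_ifs with h
      · exact (hf.2 v).1 h
      · exact ((hf.2 v).2 h).resolve_right fun h => hb ⟨v, h⟩

theorem mem_constOnOdd_of_range (hf : f ∈ HomF d) (he : e = 1 ∨ e = -1)
    (hr : Set.range f = {0, e, 2 * e}) : f ∈ constOnOdd d e := by
  refine mem_constOnOdd.2 ⟨hf.1, fun v => ?_⟩
  have hv : f v ∈ Set.range f := ⟨v, rfl⟩
  simp only [hr, Set.mem_insert_iff, Set.mem_singleton_iff] at hv
  rw [← odd_apply_iff hf, Int.odd_iff]
  omega

theorem mem_families_of_mem_HomFi (hf : f ∈ HomFi d 3) :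
    f ∈ zeroOnEven d ∪ (constOnOdd d 1 ∪ constOnOdd d (-1)) := by
  obtain ⟨hf, hc⟩ := hf
  simp only [mem_union]
  have key : ∀ e : ℤ, (e = 1 ∨ e = -1) → e ∈ Set.range f → 2 * e ∈ Set.range f →
      f ∈ constOnOdd d e := by
    intro e he h1 h2
    refine mem_constOnOdd_of_range hf he (Eq.symm ?_)
    refine Set.eq_of_subset_of_ncard_le ?_ ?_ (Set.finite_range f)
    · rintro x (rfl | rfl | rfl)
      exacts [⟨_, hf.1⟩, h1, h2]
    · rw [hc, Set.ncard_eq_toFinset_card']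
      rcases he with rfl | rfl <;> rfl
  by_cases h1 : ∃ v, 2 ≤ f v
  · obtain ⟨v, hv⟩ := h1
    exact Or.inr (Or.inl (key 1 (by omega) (mem_range_of_between hf v _ (by omega))
      (mem_range_of_between hf v _ (by omega))))
  by_cases h2 : ∃ v, f v ≤ -2
  · obtain ⟨v, hv⟩ := h2
    exact Or.inr (Or.inr (key (-1) (by omega) (mem_range_of_between hf v _ (by omega))
      (mem_range_of_between hf v _ (by omega))))
  push Not at h1 h2
  refine Or.inl (mem_zeroOnEven.2 fun v => ?_)
  have := h1 v
  have := h2 v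
  rw [← odd_apply_iff hf, Int.odd_iff]
  omega

end Membership

theorem mem_HomFi_of_mem_families {n : ℕ} {f : (Fin (n + 1) → Bool) → ℤ}
    (hf : f ∈ zeroOnEven (n + 1) ∪ (constOnOdd (n + 1) 1 ∪ constOnOdd (n + 1) (-1)))
    (h1 : f ≠ twoValued (n + 1) 1) (h2 : f ≠ twoValued (n + 1) (-1)) :
    f ∈ HomFi (n + 1) 3 := by
  simp only [mem_union] at hf
  rcases hf with hf | hf | hf
  · refine ⟨zeroOnEven_subset_HomF hf, ?_⟩
    rw [zeroOnEven_range hf h1 h2, Set.ncard_eq_toFinset_card']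
    rfl
  · refine ⟨constOnOdd_subset_HomF (by simp) hf, ?_⟩
    rw [constOnOdd_range hf h1, Set.ncard_eq_toFinset_card']
    rfl
  · refine ⟨constOnOdd_subset_HomF (by simp) hf, ?_⟩
    rw [constOnOdd_range hf h2, Set.ncard_eq_toFinset_card']
    rfl

theorem ncard_HomFi_three_le (n : ℕ) : (HomFi (n + 1) 3).ncard ≤ 2 * 2 ^ 2 ^ n := by
  have h : HomFi (n + 1) 3 ⊆
      ↑(zeroOnEven (n + 1) ∪ (constOnOdd (n + 1) 1 ∪ constOnOdd (n + 1) (-1))) :=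
    fun f hf => mem_coe.2 (mem_families_of_mem_HomFi hf)
  have h1 := Set.ncard_le_ncard h (finite_toSet _)
  rw [Set.ncard_coe_finset] at h1
  have h2 := card_union_le (zeroOnEven (n + 1)) (constOnOdd (n + 1) 1 ∪ constOnOdd (n + 1) (-1))
  have h3 := card_union_le (constOnOdd (n + 1) 1) (constOnOdd (n + 1) (-1))
  have h4 := card_zeroOnEven n
  have h5 := two_mul_card_constOnOdd n (e := 1) (by simp)
  have h6 := two_mul_card_constOnOdd n (e := -1) (by simp)
  omega

theorem le_ncard_HomFi_three (n : ℕ) : 2 * 2 ^ 2 ^ n ≤ (HomFi (n + 1) 3).ncard + 4 := by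
  have hfin : (HomFi (n + 1) 3).Finite :=
    (finite_toSet _).subset fun f hf => mem_coe.2 (mem_families_of_mem_HomFi hf)
  have h : (↑(zeroOnEven (n + 1) ∪ (constOnOdd (n + 1) 1 ∪ constOnOdd (n + 1) (-1))) : Set _) ⊆
      HomFi (n + 1) 3 ∪ {twoValued (n + 1) 1, twoValued (n + 1) (-1)} := by
    intro f hf
    by_cases h1 : f = twoValued (n + 1) 1
    · exact Or.inr (Or.inl h1)
    by_cases h2 : f = twoValued (n + 1) (-1)
    · exact Or.inr (Or.inr h2)
    exact Or.inl (mem_HomFi_of_mem_families (mem_coe.1 hf) h1 h2)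
  have h1 := Set.ncard_le_ncard h (hfin.union (Set.toFinite _))
  rw [Set.ncard_coe_finset] at h1
  have h2 := Set.ncard_union_le (HomFi (n + 1) 3) {twoValued (n + 1) 1, twoValued (n + 1) (-1)}
  have h3 := Set.ncard_insert_le (twoValued (n + 1) 1) {twoValued (n + 1) (-1)}
  rw [Set.ncard_singleton] at h3
  have hodd : Odd (weight (flip (fun _ : Fin (n + 1) => false) 0)) := by
    simp [odd_weight_flip, weight_zero]
  have hinter : zeroOnEven (n + 1) ∩ (constOnOdd (n + 1) 1 ∪ constOnOdd (n + 1) (-1)) ⊆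
      {twoValued (n + 1) 1, twoValued (n + 1) (-1)} := by
    intro f hf
    have key : ∀ e, f ∈ constOnOdd (n + 1) e → f = twoValued (n + 1) e := by
      intro e he
      ext1 v
      rw [twoValued]
      split_ifs with h
      · exact ((mem_constOnOdd.1 he).2 v).1 h
      · exact (mem_zeroOnEven.1 (mem_inter.1 hf).1 v).2 h
    rw [mem_insert, mem_singleton]
    exact (mem_union.1 (mem_inter.1 hf).2).imp (key _) (key _)
  have h4 := (card_le_card hinter).trans card_le_two
  have h5 : #(constOnOdd (n + 1) 1 ∪ constOnOdd (n + 1) (-1)) =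
      #(constOnOdd (n + 1) 1) + #(constOnOdd (n + 1) (-1)) := by
    refine card_union_of_disjoint (disjoint_left.2 fun f hf hf' => ?_)
    have h1 := ((mem_constOnOdd.1 hf).2 _).1 hodd
    have h2 := ((mem_constOnOdd.1 hf').2 _).1 hodd
    omega
  have h6 := card_union_add_card_inter (zeroOnEven (n + 1))
    (constOnOdd (n + 1) 1 ∪ constOnOdd (n + 1) (-1))
  have h7 := card_zeroOnEven n
  have h8 := two_mul_card_constOnOdd n (e := 1) (by simp)
  have h9 := two_mul_card_constOnOdd n (e := -1) (by simp)
  omega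

theorem four_le_exp_mul {n : ℕ} (hn : 4 ≤ n) :
    (4 : ℝ) ≤ Real.exp (-(1 / 2) * ((n + 1 : ℕ) : ℝ)) * 2 ^ 2 ^ n := by
  have h1 : Real.exp ((1 / 2) * ((n + 1 : ℕ) : ℝ)) ≤ 2 ^ (n + 1) := by
    rw [mul_comm, Real.exp_nat_mul]
    refine pow_le_pow_left₀ (Real.exp_nonneg _) ?_ _
    rw [← Real.le_log_iff_exp_le two_pos]
    linarith [Real.log_two_gt_d9]
  have h2 : n + 3 ≤ 2 ^ n := by
    clear h1
    induction n, hn using Nat.le_induction with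
    | base => norm_num
    | succ m _ ih => rw [pow_succ]; omega
  have h3 : (4 : ℝ) * 2 ^ (n + 1) ≤ 2 ^ 2 ^ n := by
    calc (4 : ℝ) * 2 ^ (n + 1) = 2 ^ (n + 3) := by ring
      _ ≤ 2 ^ 2 ^ n := pow_le_pow_right₀ one_le_two h2
  rw [neg_mul, Real.exp_neg, inv_mul_eq_div, le_div_iff₀ (Real.exp_pos _)]
  linarith

end HammingCube

theorem count_homF3 :
    ∃ c > (0:ℝ), ∃ d₀ : ℕ, ∀ d : ℕ, d₀ ≤ d →
      |((HomFi d 3).ncard : ℝ) - 2 * 2 ^ 2 ^ (d - 1)| ≤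
        Real.exp (-c * d) * 2 ^ 2 ^ (d - 1) := by
  refine ⟨1 / 2, by norm_num, 5, fun d hd => ?_⟩
  obtain ⟨n, rfl⟩ : ∃ n, d = n + 1 := ⟨d - 1, by omega⟩
  rw [Nat.add_sub_cancel]
  refine le_trans ?_ (HammingCube.four_le_exp_mul (n := n) (by omega))
  have h1 : ((HomFi (n + 1) 3).ncard : ℝ) ≤ 2 * 2 ^ 2 ^ n := by
    exact_mod_cast HammingCube.ncard_HomFi_three_le n
  have h2 : (2 : ℝ) * 2 ^ 2 ^ n ≤ (HomFi (n + 1) 3).ncard + 4 := by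
    exact_mod_cast HammingCube.le_ncard_HomFi_three n
  rw [abs_le]
  constructor <;> linarith
end

section
/- There exist constants c > 0 and d₀ such that for all integers d ≥ d₀, | |F_4| − (4√e − 4)·2^{2^{d−1}} | ≤ e^{−cd}·2^{2^{d−1}}. -/
section LinkedSets

variable {V : Type*} [DecidableEq V]

/-- `C` contains `v`, and every point of `C` is reached from `v` by steps `a → b ∈ nb a` that stay
inside `C`. -/
def LinkedFrom (nb : V → Finset V) (v : V) (C : Finset V) : Prop :=
  v ∈ C ∧ ∀ y ∈ C, Relation.ReflTransGen (fun a b => b ∈ C ∧ b ∈ nb a) v y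

/-- The vertex sets of the walks with `k` steps that start at `v`. -/
def walkSets (nb : V → Finset V) : ℕ → V → Finset (Finset V)
  | 0, v => {{v}}
  | k + 1, v => (nb v).biUnion fun u => (walkSets nb k u).image (insert v)

lemma card_walkSets_le {nb : V → Finset V} {D : ℕ} (hD : ∀ x, (nb x).card ≤ D) (k : ℕ) (v : V) :
    (walkSets nb k v).card ≤ D ^ k := by
  induction k generalizing v with
  | zero => simp [walkSets]
  | succ k ih =>
    rw [walkSets, pow_succ']
    refine (Finset.card_biUnion_le_card_mul _ _ (D ^ k) fun u _ =>
      Finset.card_image_le.trans (ih u)).trans ?_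
    exact Nat.mul_le_mul_right _ (hD v)

lemma mem_of_mem_walkSets {nb : V → Finset V} {k : ℕ} {v : V} {K : Finset V}
    (hK : K ∈ walkSets nb k v) : v ∈ K := by
  cases k with
  | zero => simp only [walkSets, Finset.mem_singleton] at hK; simp [hK]
  | succ k =>
    simp only [walkSets, Finset.mem_biUnion, Finset.mem_image] at hK
    obtain ⟨u, -, K', -, rfl⟩ := hK
    simp

lemma insert_mem_walkSets_succ {nb : V → Finset V} {k : ℕ} {v u : V} {K : Finset V}
    (hu : u ∈ nb v) (hK : K ∈ walkSets nb k u) : insert v K ∈ walkSets nb (k + 1) v := by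
  simp only [walkSets, Finset.mem_biUnion, Finset.mem_image]
  exact ⟨u, hu, K, hK, rfl⟩

lemma insert_mem_walkSets {nb : V → Finset V} (hsymm : ∀ x y, y ∈ nb x → x ∈ nb y) {k : ℕ}
    {v w u : V} {K : Finset V} (hK : K ∈ walkSets nb k v) (hw : w ∈ K) (hu : u ∈ nb w) :
    insert u K ∈ walkSets nb (k + 2) v := by
  have bounce : ∀ {k v K}, K ∈ walkSets nb k v → u ∈ nb v → insert u K ∈ walkSets nb (k + 2) v := by
    intro k v K hK hu
    have := insert_mem_walkSets_succ hu (insert_mem_walkSets_succ (hsymm _ _ hu) hK)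
    rwa [Finset.insert_comm, Finset.insert_eq_of_mem (mem_of_mem_walkSets hK)] at this
  induction k generalizing v K with
  | zero =>
    have h := hK
    simp only [walkSets, Finset.mem_singleton] at h
    subst h
    rw [Finset.mem_singleton] at hw
    exact bounce hK (hw ▸ hu)
  | succ k ih =>
    by_cases hwv : w = v
    · exact bounce hK (hwv ▸ hu)
    · simp only [walkSets, Finset.mem_biUnion, Finset.mem_image] at hK
      obtain ⟨x, hx, K', hK', rfl⟩ := hK
      rw [Finset.insert_comm]
      exact insert_mem_walkSets_succ hx (ih hK' (Finset.mem_of_mem_insert_of_ne hw hwv))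

lemma LinkedFrom.exists_step {nb : V → Finset V} {v : V} {C K : Finset V}
    (hC : LinkedFrom nb v C) (hv : v ∈ K) (hne : ¬ C ⊆ K) :
    ∃ w ∈ K, ∃ u ∈ C, u ∉ K ∧ u ∈ nb w := by
  obtain ⟨y, hyC, hyK⟩ := Finset.not_subset.1 hne
  by_contra! h
  have : ∀ z, Relation.ReflTransGen (fun a b => b ∈ C ∧ b ∈ nb a) v z → z ∈ K := by
    intro z hz
    induction hz with
    | refl => exact hv
    | tail _ hbc ih =>
      by_contra hcK
      exact h _ ih _ hbc.1 hcK hbc.2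
  exact hyK (this y (hC.2 y hyC))

lemma LinkedFrom.mem_walkSets {nb : V → Finset V} (hrefl : ∀ x, x ∈ nb x)
    (hsymm : ∀ x y, y ∈ nb x → x ∈ nb y) {v : V} {C : Finset V} (hC : LinkedFrom nb v C) {m : ℕ}
    (hm : C.card ≤ m + 1) : C ∈ walkSets nb (2 * m) v := by
  have key : ∀ j : ℕ, ∃ K ∈ walkSets nb (2 * j) v, K ⊆ C ∧ (j + 1 ≤ K.card ∨ K = C) := by
    intro j
    induction j with
    | zero => exact ⟨{v}, by simp [walkSets], by simpa using hC.1, by simp⟩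
    | succ j ih =>
      obtain ⟨K, hK, hKC, hcard⟩ := ih
      have hvK := mem_of_mem_walkSets hK
      by_cases hCK : C ⊆ K
      · refine ⟨K, ?_, hKC, Or.inr (hKC.antisymm hCK)⟩
        have := insert_mem_walkSets hsymm hK hvK (hrefl v)
        rwa [Finset.insert_eq_of_mem hvK] at this
      · obtain ⟨w, hw, u, huC, huK, hu⟩ := hC.exists_step hvK hCK
        refine ⟨insert u K, insert_mem_walkSets hsymm hK hw hu,
          Finset.insert_subset huC hKC, Or.inl ?_⟩
        rw [Finset.card_insert_of_notMem huK]
        rcases hcard with h | h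
        · omega
        · exact absurd h.symm.subset hCK
  obtain ⟨K, hK, hKC, h⟩ := key m
  have : K = C := h.elim (fun h => Finset.eq_of_subset_of_card_le hKC (hm.trans h)) id
  exact this ▸ hK

end LinkedSets

section CubeIsoperimetry

open Finset

/-- The point `x` of the cube with the `i`-th coordinate flipped. -/
def flipAt {n : ℕ} (x : Fin n → Bool) (i : Fin n) : Fin n → Bool :=
  Function.update x i (!x i)

/-- The closed neighbourhood of `x` in the cube. -/
def ballOne {n : ℕ} (x : Fin n → Bool) : Finset (Fin n → Bool) :=
  insert x (univ.image (flipAt x))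

lemma flipAt_apply_self {n : ℕ} (x : Fin n → Bool) (i : Fin n) : flipAt x i i = !x i := by
  simp [flipAt]

lemma flipAt_apply_of_ne {n : ℕ} (x : Fin n → Bool) {i j : Fin n} (h : j ≠ i) :
    flipAt x i j = x j := by
  simp [flipAt, h]

lemma flipAt_flipAt {n : ℕ} (x : Fin n → Bool) (i : Fin n) : flipAt (flipAt x i) i = x := by
  simp [flipAt]

lemma flipAt_ne {n : ℕ} (x : Fin n → Bool) (i : Fin n) : flipAt x i ≠ x := by
  intro h
  have := congrFun h i
  simp [flipAt_apply_self] at this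

lemma flipAt_injective {n : ℕ} (x : Fin n → Bool) : Function.Injective (flipAt x) := by
  intro i j h
  by_contra hij
  have := congrFun h i
  rw [flipAt_apply_self, flipAt_apply_of_ne x hij] at this
  simp at this

lemma mem_ballOne {n : ℕ} {x y : Fin n → Bool} :
    y ∈ ballOne x ↔ y = x ∨ ∃ i, flipAt x i = y := by
  simp [ballOne]

lemma mem_ballOne_symm {n : ℕ} (x y : Fin n → Bool) (h : y ∈ ballOne x) : x ∈ ballOne y := by
  rw [mem_ballOne] at h ⊢
  rcases h with rfl | ⟨i, rfl⟩
  · exact Or.inl rfl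
  · exact Or.inr ⟨i, flipAt_flipAt x i⟩

lemma card_ballOne {n : ℕ} (x : Fin n → Bool) : (ballOne x).card = n + 1 := by
  rw [ballOne, card_insert_of_notMem, card_image_of_injective _ (flipAt_injective x)]
  · simp
  · simp only [mem_image, mem_univ, true_and, not_exists]
    exact flipAt_ne x

lemma eq_flipAt_of_mem_ballOne {n : ℕ} {x z : Fin n → Bool} {i : Fin n} (hz : z ∈ ballOne x)
    (hi : z i ≠ x i) : z = flipAt x i := by
  rcases mem_ballOne.1 hz with rfl | ⟨j, rfl⟩
  · exact absurd rfl hi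
  · by_cases hij : i = j
    · rw [hij]
    · exact absurd (flipAt_apply_of_ne x hij) hi

lemma card_ballOne_inter_le {n : ℕ} (x y : Fin n → Bool) (hxy : x ≠ y) :
    (ballOne x ∩ ballOne y).card ≤ 2 := by
  obtain ⟨i, hi⟩ := Function.ne_iff.1 hxy
  refine (card_le_card (t := {flipAt x i, flipAt y i}) fun z hz => ?_).trans card_le_two
  rw [mem_inter] at hz
  rw [mem_insert, mem_singleton]
  by_cases h : z i = x i
  · exact Or.inr (eq_flipAt_of_mem_ballOne hz.2 (h ▸ hi))
  · exact Or.inl (eq_flipAt_of_mem_ballOne hz.1 h)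

/-- The number of neighbours of `x` outside `A`. -/
def outDegree {n : ℕ} (A : Finset (Fin n → Bool)) (x : Fin n → Bool) : ℕ :=
  (univ.filter fun i => flipAt x i ∉ A).card

lemma sqrt_sum_sq_add_sum_sq_le {ι : Type*} (s : Finset ι) (X Y : ι → ℝ) :
    √((∑ i ∈ s, X i) ^ 2 + (∑ i ∈ s, Y i) ^ 2) ≤ ∑ i ∈ s, √(X i ^ 2 + Y i ^ 2) := by
  set a := ∑ i ∈ s, X i
  set b := ∑ i ∈ s, Y i
  set r := √(a ^ 2 + b ^ 2)
  have hr2 : r ^ 2 = a ^ 2 + b ^ 2 := Real.sq_sqrt (by positivity)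
  rcases (Real.sqrt_nonneg (a ^ 2 + b ^ 2)).eq_or_lt with h | h
  · rw [show r = 0 from h.symm]
    exact sum_nonneg fun i _ => Real.sqrt_nonneg _
  refine le_of_mul_le_mul_left ?_ h
  calc r * r = a * a + b * b := by rw [← sq, hr2]; ring
    _ = ∑ i ∈ s, (a * X i + b * Y i) := by rw [sum_add_distrib, ← mul_sum, ← mul_sum]
    _ ≤ ∑ i ∈ s, r * √(X i ^ 2 + Y i ^ 2) := by
      refine sum_le_sum fun i _ => ?_
      rw [← Real.sqrt_mul (by positivity)]
      refine Real.le_sqrt_of_sq_le ?_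
      nlinarith [sq_nonneg (a * Y i - b * X i)]
    _ = r * ∑ i ∈ s, √(X i ^ 2 + Y i ^ 2) := by rw [mul_sum]

lemma two_point_isoperimetry {p q : ℝ} (hq : 0 ≤ q) (hqp : q ≤ p) (hp : p ≤ 1) :
    (p + q) * (2 - (p + q)) ≤ 2 * (√((p * (1 - p)) ^ 2 + (p - q) ^ 2) + q * (1 - q)) := by
  have h : p * (1 - p) + (p - q) ^ 2 / 2 ≤ √((p * (1 - p)) ^ 2 + (p - q) ^ 2) := by
    refine Real.le_sqrt_of_sq_le ?_
    have h1 : p * (1 - p) ≤ 1 / 4 := by nlinarith [sq_nonneg (p - 1 / 2)]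
    have h2 : (p - q) ^ 2 ≤ 1 := by nlinarith
    nlinarith [mul_nonneg (sq_nonneg (p - q))
      (show 0 ≤ 1 - p * (1 - p) - (p - q) ^ 2 / 4 by linarith)]
  nlinarith

/-- The slice of `A` with first coordinate `b`. -/
def cubeSlice {n : ℕ} (A : Finset (Fin (n + 1) → Bool)) (b : Bool) : Finset (Fin n → Bool) :=
  univ.filter fun y => (Fin.cons b y : Fin (n + 1) → Bool) ∈ A

lemma mem_cubeSlice {n : ℕ} {A : Finset (Fin (n + 1) → Bool)} {b : Bool} {y : Fin n → Bool} :
    y ∈ cubeSlice A b ↔ (Fin.cons b y : Fin (n + 1) → Bool) ∈ A := by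
  simp [cubeSlice]

lemma sum_cubeSlice {n : ℕ} (A : Finset (Fin (n + 1) → Bool)) (b : Bool)
    (φ : (Fin (n + 1) → Bool) → ℝ) :
    ∑ x ∈ A, φ x = ∑ y ∈ cubeSlice A b, φ (Fin.cons b y) +
      ∑ y ∈ cubeSlice A !b, φ (Fin.cons (!b) y) := by
  have h : ∀ b, ∑ y ∈ cubeSlice A b, φ (Fin.cons b y) = ∑ x ∈ A.filter (fun x => x 0 = b), φ x := by
    intro b
    refine sum_bij (fun y _ => Fin.cons b y) ?_ ?_ ?_ (fun _ _ => rfl)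
    · intro y hy
      simpa [mem_cubeSlice] using hy
    · intro y _ z _ hyz
      exact Fin.cons_right_injective (α := fun _ => Bool) b hyz
    · intro x hx
      rw [mem_filter] at hx
      have hx' : (Fin.cons b (Fin.tail x) : Fin (n + 1) → Bool) = x := by
        rw [← hx.2]; exact Fin.cons_self_tail x
      exact ⟨Fin.tail x, by rw [mem_cubeSlice, hx']; exact hx.1, hx'⟩
  rw [h b, h !b, ← sum_filter_add_sum_filter_not A (fun x => x 0 = b)]
  congr 2
  ext x
  simp only [mem_filter, Bool.eq_not]

lemma flipAt_cons_zero {n : ℕ} (b : Bool) (y : Fin n → Bool) :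
    flipAt (Fin.cons b y : Fin (n + 1) → Bool) 0 = Fin.cons (!b) y := by
  simp [flipAt]

lemma flipAt_cons_succ {n : ℕ} (b : Bool) (y : Fin n → Bool) (i : Fin n) :
    flipAt (Fin.cons b y : Fin (n + 1) → Bool) i.succ = Fin.cons b (flipAt y i) := by
  simp [flipAt]

lemma outDegree_cons {n : ℕ} (A : Finset (Fin (n + 1) → Bool)) (b : Bool) (y : Fin n → Bool) :
    outDegree A (Fin.cons b y) =
      outDegree (cubeSlice A b) y + if y ∈ cubeSlice A !b then 0 else 1 := by
  simp only [outDegree, card_filter, Fin.sum_univ_succ, flipAt_cons_zero, flipAt_cons_succ,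
    mem_cubeSlice]
  rw [add_comm]
  congr 1
  split_ifs <;> simp_all

theorem card_mul_card_compl_le_sum_sqrt_outDegree {n : ℕ} (A : Finset (Fin n → Bool)) :
    (A.card : ℝ) * (2 ^ n - A.card) ≤ 2 ^ n * ∑ x ∈ A, √(outDegree A x) := by
  induction n with
  | zero =>
    have : A.card ≤ 1 := by simpa using card_le_univ A
    have h : (0 : ℝ) ≤ ∑ x ∈ A, √(outDegree A x) := sum_nonneg fun i _ => Real.sqrt_nonneg _
    interval_cases h : A.card <;> simp_all
  | succ n ih =>
    obtain ⟨b, hb⟩ : ∃ b, (cubeSlice A !b).card ≤ (cubeSlice A b).card := by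
      rcases le_total (cubeSlice A true).card (cubeSlice A false).card with h | h
      exacts [⟨false, h⟩, ⟨true, h⟩]
    set P := cubeSlice A b
    set Q := cubeSlice A !b
    have hm : (0 : ℝ) < 2 ^ n := by positivity
    have hcard : (A.card : ℝ) = P.card + Q.card := by
      simpa using sum_cubeSlice A b fun _ => (1 : ℝ)
    have hQ : ∑ y ∈ Q, √(outDegree Q y) ≤ ∑ y ∈ Q, √(outDegree A (Fin.cons (!b) y)) := by
      refine sum_le_sum fun y _ => Real.sqrt_le_sqrt ?_
      rw [outDegree_cons]
      exact_mod_cast Nat.le_add_right _ _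
    have hdiff : (P.card : ℝ) - Q.card ≤ ∑ y ∈ P, if y ∈ Q then (0 : ℝ) else 1 := by
      have h1 : ∑ y ∈ P, (if y ∈ Q then (0 : ℝ) else 1) = ((P \ Q).card : ℝ) := by
        rw [← filter_notMem_eq_sdiff, card_filter]
        push_cast
        exact sum_congr rfl fun y _ => by split_ifs <;> simp_all
      rw [h1, sub_le_iff_le_add]
      exact_mod_cast (card_le_card_sdiff_add_card (s := P) (t := Q))
    have hP : √((∑ y ∈ P, √(outDegree P y)) ^ 2 + ((P.card : ℝ) - Q.card) ^ 2) ≤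
        ∑ y ∈ P, √(outDegree A (Fin.cons b y)) := by
      refine le_trans ?_ ((sqrt_sum_sq_add_sum_sq_le P (fun y => √(outDegree P y))
        fun y => if y ∈ Q then (0 : ℝ) else 1).trans (sum_le_sum fun y _ => ?_))
      · refine Real.sqrt_le_sqrt (add_le_add_right (pow_le_pow_left₀ ?_ hdiff 2) _)
        rw [sub_nonneg]; exact_mod_cast hb
      · rw [outDegree_cons, Real.sq_sqrt (Nat.cast_nonneg _)]
        refine Real.sqrt_le_sqrt (le_of_eq ?_)
        push_cast
        congr 1
        show _ = if y ∈ Q then (0 : ℝ) else 1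
        split_ifs <;> simp
    have hPc : (P.card : ℝ) ≤ 2 ^ n := by
      have := card_le_univ P
      simp only [Fintype.card_pi, Fintype.card_bool, prod_const, card_univ,
        Fintype.card_fin] at this
      exact_mod_cast this
    set p : ℝ := P.card / 2 ^ n with hp
    set q : ℝ := Q.card / 2 ^ n with hq
    have hPp : (P.card : ℝ) = p * 2 ^ n := (div_mul_cancel₀ _ hm.ne').symm
    have hQq : (Q.card : ℝ) = q * 2 ^ n := (div_mul_cancel₀ _ hm.ne').symm
    have hp0 : 0 ≤ p := div_nonneg (Nat.cast_nonneg _) hm.le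
    have hq0 : 0 ≤ q := div_nonneg (Nat.cast_nonneg _) hm.le
    have hp1 : p ≤ 1 := by rw [hp, div_le_one hm]; exact hPc
    have hqp : q ≤ p := by
      rw [hp, hq]; exact div_le_div_of_nonneg_right (by exact_mod_cast hb) hm.le
    clear_value p q
    have ihP : 2 ^ n * (p * (1 - p)) ≤ ∑ y ∈ P, √(outDegree P y) := by
      have := ih P
      rw [hPp] at this
      refine le_of_mul_le_mul_left (le_trans (le_of_eq ?_) this) hm
      ring
    have ihQ : 2 ^ n * (q * (1 - q)) ≤ ∑ y ∈ Q, √(outDegree Q y) := by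
      have := ih Q
      rw [hQq] at this
      refine le_of_mul_le_mul_left (le_trans (le_of_eq ?_) this) hm
      ring
    have hP' : 2 ^ n * √((p * (1 - p)) ^ 2 + (p - q) ^ 2) ≤
        ∑ y ∈ P, √(outDegree A (Fin.cons b y)) := by
      refine le_trans ?_ hP
      refine Real.le_sqrt_of_sq_le ?_
      rw [mul_pow, Real.sq_sqrt (by positivity), hPp, hQq, mul_add, ← mul_pow]
      have : (0 : ℝ) ≤ 2 ^ n * (p * (1 - p)) := by
        have : 0 ≤ 1 - p := by linarith
        positivity
      have := pow_le_pow_left₀ this ihP 2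
      nlinarith
    have h2 := two_point_isoperimetry hq0 hqp hp1
    rw [sum_cubeSlice A b, hcard, hPp, hQq, pow_succ]
    have h3 : 2 ^ n * ((p + q) * (2 - (p + q))) ≤ 2 * (∑ y ∈ P, √(outDegree A (Fin.cons b y)) +
        ∑ y ∈ Q, √(outDegree A (Fin.cons (!b) y))) := by
      have := mul_le_mul_of_nonneg_left h2 hm.le
      linarith
    have := mul_le_mul_of_nonneg_left h3 hm.le
    linarith

theorem card_le_two_mul_sqrt_mul_boundary {n : ℕ} (A : Finset (Fin n → Bool))
    (hA : 2 * A.card ≤ 2 ^ n) :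
    (A.card : ℝ) ≤ 2 * √((n + 1 : ℕ) : ℝ) * ((A.biUnion ballOne).card - A.card) := by
  have h := card_mul_card_compl_le_sum_sqrt_outDegree Aᶜ
  have hc : ((Aᶜ).card : ℝ) = 2 ^ n - A.card := by
    rw [card_compl, Nat.cast_sub (card_le_univ A)]
    simp
  have hsub : A ⊆ A.biUnion ballOne := fun x hx =>
    mem_biUnion.2 ⟨x, hx, mem_insert_self _ _⟩
  have hsum : ∑ x ∈ Aᶜ, √(outDegree Aᶜ x) ≤
      √((n + 1 : ℕ) : ℝ) * ((A.biUnion ballOne).card - A.card) := by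
    have hb : ((A.biUnion ballOne).card : ℝ) - A.card = ((A.biUnion ballOne \ A).card : ℝ) := by
      rw [card_sdiff_of_subset hsub, Nat.cast_sub (card_le_card hsub)]
    rw [hb, mul_comm, ← nsmul_eq_mul, ← sum_const]
    have hss : A.biUnion ballOne \ A ⊆ Aᶜ := by
      intro x hx; rw [mem_compl]; exact (mem_sdiff.1 hx).2
    rw [← sum_subset hss]
    · refine sum_le_sum fun x _ => Real.sqrt_le_sqrt ?_
      have : outDegree Aᶜ x ≤ n := (card_le_univ _).trans (by simp)
      exact_mod_cast this.trans (Nat.le_succ n)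
    · intro x hx hx'
      have : outDegree Aᶜ x = 0 := by
        rw [outDegree, card_eq_zero, filter_eq_empty_iff]
        intro i _ hi
        rw [mem_compl, not_not] at hi
        refine hx' (mem_sdiff.2 ⟨mem_biUnion.2 ⟨_, hi, ?_⟩, mem_compl.1 hx⟩)
        exact mem_ballOne.2 (Or.inr ⟨i, flipAt_flipAt x i⟩)
      rw [this]; simp
  have hm : (0 : ℝ) < 2 ^ n := by positivity
  have hA' : 2 * (A.card : ℝ) ≤ 2 ^ n := by exact_mod_cast hA
  rw [hc] at h
  have h1 := h.trans (mul_le_mul_of_nonneg_left hsum hm.le)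
  have h2 : 2 ^ n * (A.card : ℝ) ≤
      2 ^ n * (2 * (√((n + 1 : ℕ) : ℝ) * ((A.biUnion ballOne).card - A.card))) := by
    nlinarith [mul_nonneg (Nat.cast_nonneg A.card : (0 : ℝ) ≤ A.card) (sub_nonneg.2 hA')]
  have := le_of_mul_le_mul_left h2 hm
  linarith

end CubeIsoperimetry

section PolymerBound

open Finset

open Classical in
/-- The part of `A` that is linked to `v` inside `A`. -/
noncomputable def linkedComponent {V : Type*} (nb : V → Finset V) (v : V) (A : Finset V) :
    Finset V :=
  A.filter fun y => Relation.ReflTransGen (fun a b => b ∈ A ∧ b ∈ nb a) v y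

lemma linkedComponent_subset {V : Type*} (nb : V → Finset V) (v : V) (A : Finset V) :
    linkedComponent nb v A ⊆ A := by
  classical exact filter_subset _ _

lemma linkedFrom_linkedComponent {V : Type*} {nb : V → Finset V} {v : V} {A : Finset V}
    (hv : v ∈ A) : LinkedFrom nb v (linkedComponent nb v A) := by
  refine ⟨by simp [linkedComponent, hv, Relation.ReflTransGen.refl], fun y hy => ?_⟩
  have h : Relation.ReflTransGen (fun a b => b ∈ A ∧ b ∈ nb a) v y := by
    simp only [linkedComponent, mem_filter] at hy; exact hy.2
  clear hy
  induction h with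
  | refl => exact .refl
  | tail hab hbc ih =>
    refine ih.tail ⟨?_, hbc.2⟩
    simp only [linkedComponent, mem_filter]
    exact ⟨hbc.1, hab.tail hbc⟩

variable {V : Type*} [DecidableEq V]

/-- The two-step neighbourhood of `x` with respect to `N`. -/
def nbTwo (N : V → Finset V) (x : V) : Finset V := (N x).biUnion N

lemma mem_nbTwo {N : V → Finset V} {x y : V} : y ∈ nbTwo N x ↔ ∃ z ∈ N x, y ∈ N z := by
  simp [nbTwo]

lemma mem_nbTwo_symm {N : V → Finset V} (hN : ∀ x y, y ∈ N x → x ∈ N y) (x y : V)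
    (h : y ∈ nbTwo N x) : x ∈ nbTwo N y := by
  obtain ⟨z, hz, hy⟩ := mem_nbTwo.1 h
  exact mem_nbTwo.2 ⟨z, hN _ _ hy, hN _ _ hz⟩

lemma card_biUnion_linkedComponent_add {N : V → Finset V} (hN : ∀ x y, y ∈ N x → x ∈ N y) (v : V)
    (A : Finset V) :
    ((linkedComponent (nbTwo N) v A).biUnion N).card +
      ((A \ linkedComponent (nbTwo N) v A).biUnion N).card = (A.biUnion N).card := by
  set C := linkedComponent (nbTwo N) v A with hC
  have hCA : C ⊆ A := linkedComponent_subset _ _ _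
  rw [← card_union_of_disjoint, ← union_biUnion, union_sdiff_of_subset hCA]
  rw [disjoint_left]
  intro z hz hz'
  obtain ⟨c, hc, hzc⟩ := mem_biUnion.1 hz
  obtain ⟨b, hb, hzb⟩ := mem_biUnion.1 hz'
  rw [mem_sdiff] at hb
  refine hb.2 ?_
  simp only [hC, linkedComponent, mem_filter] at hc ⊢
  exact ⟨hb.1, hc.2.tail ⟨hb.1, mem_nbTwo.2 ⟨z, hzc, hN _ _ hzb⟩⟩⟩

open Classical in
/-- A sum over vertex sets whose weight factors over linked components is controlled by the
weights of the linked sets through each vertex. -/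
theorem sum_weight_le_one_add_pow [Fintype V] {N : V → Finset V} (hN : ∀ x y, y ∈ N x → x ∈ N y)
    {P : Finset V → Prop} (hP : ∀ A B, A ⊆ B → P B → P A) {η : ℝ} (hη : 0 ≤ η)
    (h : ∀ v, ∑ C with LinkedFrom (nbTwo N) v C ∧ P C, (1 / 2 : ℝ) ^ (C.biUnion N).card ≤ η) :
    ∑ A with P A, (1 / 2 : ℝ) ^ (A.biUnion N).card ≤ (1 + η) ^ Fintype.card V := by
  have key : ∀ X : Finset V, ∑ A ∈ X.powerset with P A, (1 / 2 : ℝ) ^ (A.biUnion N).card ≤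
      (1 + η) ^ X.card := by
    intro X
    induction X using Finset.induction_on with
    | empty =>
      rw [powerset_empty, filter_singleton]
      split_ifs <;> simp
    | insert v X hvX ih =>
      rw [← sum_filter_add_sum_filter_not _ (fun A => v ∉ A), card_insert_of_notMem hvX, pow_succ,
        mul_add, mul_one]
      refine add_le_add (le_trans (le_of_eq (sum_congr ?_ fun _ _ => rfl)) ih) ?_
      · ext A
        simp only [mem_filter, mem_powerset]
        constructor
        · rintro ⟨⟨h1, h2⟩, h3⟩
          exact ⟨(subset_insert_iff_of_notMem h3).1 h1, h2⟩
        · rintro ⟨h1, h2⟩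
          exact ⟨⟨h1.trans (subset_insert _ _), h2⟩, fun h => hvX (h1 h)⟩
      · set S := ((insert v X).powerset.filter P).filter fun A => ¬ v ∉ A
        set f : Finset V → Finset V × Finset V := fun A =>
          (linkedComponent (nbTwo N) v A, A \ linkedComponent (nbTwo N) v A)
        set T : Finset (Finset V) := univ.filter fun C => LinkedFrom (nbTwo N) v C ∧ P C
        set F : Finset V × Finset V → ℝ := fun p =>
          (1 / 2 : ℝ) ^ (p.1.biUnion N).card * (1 / 2 : ℝ) ^ (p.2.biUnion N).card
        have hS : ∀ A ∈ S, A ⊆ insert v X ∧ P A ∧ v ∈ A := by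
          intro A hA
          simp only [S, mem_filter, mem_powerset, not_not] at hA
          exact ⟨hA.1.1, hA.1.2, hA.2⟩
        have hinj : Set.InjOn f S := by
          intro A hA B hB hAB
          simp only [f, Prod.mk.injEq] at hAB
          rw [← union_sdiff_of_subset (linkedComponent_subset (nbTwo N) v A), hAB.2, hAB.1,
            union_sdiff_of_subset (linkedComponent_subset (nbTwo N) v B)]
        have hmaps : S.image f ⊆ T ×ˢ (X.powerset.filter P) := by
          intro p hp
          obtain ⟨A, hA, rfl⟩ := mem_image.1 hp
          obtain ⟨hAX, hPA, hvA⟩ := hS A hA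
          have hlink := linkedFrom_linkedComponent (nb := nbTwo N) hvA
          simp only [f, mem_product, T, mem_filter, mem_univ, true_and, mem_powerset]
          refine ⟨⟨hlink, hP _ _ (linkedComponent_subset _ _ _) hPA⟩, ?_, hP _ _ sdiff_subset hPA⟩
          intro x hx
          rw [mem_sdiff] at hx
          refine mem_of_mem_insert_of_ne (hAX hx.1) ?_
          rintro rfl
          exact hx.2 hlink.1
        calc ∑ A ∈ S, (1 / 2 : ℝ) ^ (A.biUnion N).card = ∑ A ∈ S, F (f A) := by
              refine sum_congr rfl fun A hA => ?_
              rw [← card_biUnion_linkedComponent_add hN v A, pow_add]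
          _ = ∑ p ∈ S.image f, F p := (sum_image hinj).symm
          _ ≤ ∑ p ∈ T ×ˢ (X.powerset.filter P), F p :=
              sum_le_sum_of_subset_of_nonneg hmaps fun p _ _ => by positivity
          _ = (∑ C ∈ T, (1 / 2 : ℝ) ^ (C.biUnion N).card) *
                ∑ A ∈ X.powerset with P A, (1 / 2 : ℝ) ^ (A.biUnion N).card := by
              rw [sum_product, sum_mul_sum]
          _ ≤ η * (1 + η) ^ X.card := mul_le_mul (h v) ih (sum_nonneg fun _ _ => by positivity) hη
          _ = (1 + η) ^ X.card * η := mul_comm _ _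
  have := key univ
  rwa [powerset_univ, card_univ] at this

end PolymerBound

section CubeLike

open Finset

/-- The properties of the bipartite cube graph that the counting argument uses. Both sides of the
bipartition are identified with `V`, and `N x` is the set of neighbours of `x`. -/
structure CubeLike {V : Type*} [Fintype V] [DecidableEq V] (N : V → Finset V) (d : ℕ) : Prop where
  symm : ∀ x y, y ∈ N x → x ∈ N y
  card_nbr : ∀ x, (N x).card = d
  codegree : ∀ x y, x ≠ y → (N x ∩ N y).card ≤ 2
  card_univ : Fintype.card V = 2 ^ (d - 1)
  expand : ∀ A : Finset V, 2 * A.card ≤ Fintype.card V →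
    (A.card : ℝ) ≤ 2 * √d * ((A.biUnion N).card - A.card)

variable {V : Type*} [DecidableEq V]

lemma sum_card_nbr_inter_comm {N : V → Finset V} (hN : ∀ x y, y ∈ N x → x ∈ N y)
    (A B : Finset V) : ∑ x ∈ A, (N x ∩ B).card = ∑ y ∈ B, (N y ∩ A).card := by
  have h := sum_card_bipartiteAbove_eq_sum_card_bipartiteBelow (s := A) (t := B)
    (fun x y => y ∈ N x)
  convert h using 3 with x _ y _
  · ext z; simp [bipartiteAbove, and_comm]
  · ext z; simp only [bipartiteBelow, mem_inter, mem_filter]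
    exact ⟨fun h => ⟨h.2, hN _ _ h.1⟩, fun h => ⟨hN _ _ h.2, h.1⟩⟩

variable [Fintype V]

/-- The points all of whose neighbours lie in `G`. -/
def interiorOf (N : V → Finset V) (G : Finset V) : Finset V := univ.filter fun x => N x ⊆ G

lemma mem_interiorOf {N : V → Finset V} {G : Finset V} {x : V} :
    x ∈ interiorOf N G ↔ N x ⊆ G := by simp [interiorOf]

lemma subset_interiorOf_biUnion (N : V → Finset V) (A : Finset V) :
    A ⊆ interiorOf N (A.biUnion N) :=
  fun _ hx => mem_interiorOf.2 (subset_biUnion_of_mem N hx)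

lemma biUnion_interiorOf_biUnion (N : V → Finset V) (A : Finset V) :
    (interiorOf N (A.biUnion N)).biUnion N = A.biUnion N :=
  (biUnion_subset.2 fun _ hx => mem_interiorOf.1 hx).antisymm
    (biUnion_subset_biUnion_of_subset_left _ (subset_interiorOf_biUnion N A))

namespace CubeLike

variable {N : V → Finset V} {d : ℕ}

lemma card_biUnion_le (h : CubeLike N d) (A : Finset V) : (A.biUnion N).card ≤ A.card * d :=
  card_biUnion_le_card_mul _ _ _ fun x _ => (h.card_nbr x).le

lemma sum_card_nbr_inter_biUnion (h : CubeLike N d) (A : Finset V) {B G : Finset V}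
    (hB : B ⊆ A) (hG : A.biUnion N ⊆ G) : ∑ z ∈ G, (N z ∩ B).card = d * B.card := by
  rw [← sum_card_nbr_inter_comm h.symm, mul_comm, ← smul_eq_mul, ← sum_const]
  refine sum_congr rfl fun x hx => ?_
  rw [inter_eq_left.2 ((subset_biUnion_of_mem N (hB hx)).trans hG), h.card_nbr]

lemma card_mul_sq_add_le (h : CubeLike N d) {A : Finset V} (hA : A.Nonempty) :
    d ^ 2 * A.card + 2 * (A.biUnion N).card ≤ (A.biUnion N).card * (d + 2 * A.card) := by
  set G := A.biUnion N
  have h1 : ∑ z ∈ G, (N z ∩ A).card = d * A.card :=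
    h.sum_card_nbr_inter_biUnion A subset_rfl subset_rfl
  have h2 : ∑ z ∈ G, (N z ∩ A).card ^ 2 + 2 * A.card ≤ A.card * (d + 2 * A.card) := by
    have e1 : ∀ z, (N z ∩ A).card ^ 2 = ∑ x ∈ A, ∑ y ∈ A, if z ∈ N x ∩ N y then 1 else 0 := by
      intro z
      have : N z ∩ A = A.filter fun x => z ∈ N x := by
        ext x
        simp only [mem_inter, mem_filter]
        exact ⟨fun h' => ⟨h'.2, h.symm _ _ h'.1⟩, fun h' => ⟨h.symm _ _ h'.2, h'.1⟩⟩
      rw [this, card_filter, sq, sum_mul_sum]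
      refine sum_congr rfl fun x _ => sum_congr rfl fun y _ => ?_
      simp only [mem_inter]
      split_ifs <;> simp_all
    have e2 : ∑ z ∈ G, (N z ∩ A).card ^ 2 ≤ ∑ x ∈ A, ∑ y ∈ A, (N x ∩ N y).card := by
      rw [sum_congr rfl fun z _ => e1 z, sum_comm]
      refine sum_le_sum fun x _ => ?_
      rw [sum_comm]
      refine sum_le_sum fun y _ => ?_
      rw [sum_boole, Nat.cast_id]
      exact card_le_card fun z hz => (mem_filter.1 hz).2
    have e3 : ∀ x ∈ A, ∑ y ∈ A, (N x ∩ N y).card + 2 ≤ d + 2 * A.card := by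
      intro x hx
      rw [← add_sum_erase _ _ hx, inter_self, h.card_nbr]
      have : ∑ y ∈ A.erase x, (N x ∩ N y).card ≤ (A.erase x).card * 2 := by
        rw [← smul_eq_mul]
        exact sum_le_card_nsmul _ _ _ fun y hy => h.codegree x y (ne_of_mem_erase hy).symm
      rw [card_erase_of_mem hx] at this
      have := card_pos.2 ⟨x, hx⟩
      omega
    have e4 := sum_le_sum e3
    rw [sum_add_distrib, sum_const, sum_const, smul_eq_mul, smul_eq_mul] at e4
    linarith
  have h3 : (d * A.card) ^ 2 ≤ G.card * ∑ z ∈ G, (N z ∩ A).card ^ 2 := by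
    rw [← h1]; exact sq_sum_le_card_mul_sum_sq
  refine Nat.le_of_mul_le_mul_left ?_ (card_pos.2 hA)
  nlinarith [Nat.mul_le_mul_left G.card h2]

lemma card_le_of_card_biUnion_lt (h : CubeLike N d) {A : Finset V} (hA : A.Nonempty)
    (hG : 10 * (A.biUnion N).card < d ^ 2) : 8 * A.card ≤ d := by
  have h1 := h.card_mul_sq_add_le hA
  by_contra! hlt
  have hpos := card_pos.2 hA
  generalize (A.biUnion N).card = g at *
  generalize A.card = a at *
  have : g * (d + 2 * a) ≤ g * (10 * a) := Nat.mul_le_mul_left _ (by omega)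
  nlinarith

lemma linear_lower_bound_card_biUnion (h : CubeLike N d) {A : Finset V} (hA : 2 ≤ A.card)
    (hG : 10 * (A.biUnion N).card < d ^ 2) {L : ℕ} (hL : 16 * L ≤ d) :
    8 * L * (A.card - 1) + 3 * d ≤ 2 * (A.biUnion N).card := by
  have hne : A.Nonempty := card_pos.1 (by omega)
  have h1 := h.card_mul_sq_add_le hne
  have h2 := h.card_le_of_card_biUnion_lt hne hG
  generalize (A.biUnion N).card = g at *
  generalize A.card = a at *
  obtain ⟨k, rfl⟩ : ∃ k, a = k + 1 := ⟨a - 1, by omega⟩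
  obtain ⟨e, rfl⟩ : ∃ e, d = 8 * (k + 1) + e := ⟨d - 8 * (k + 1), by omega⟩
  simp only [Nat.add_sub_cancel]
  have h3 : (k + 1) * (8 * (k + 1) + e - 2 * k) ≤ g := by
    have hs : 8 * (k + 1) + e - 2 * k = 6 * k + 8 + e := by omega
    rw [hs]
    refine Nat.le_of_mul_le_mul_right ?_ (show 0 < 8 * (k + 1) + e + 2 * k by omega)
    have hx : (6 * k + 8 + e) * (8 * (k + 1) + e + 2 * k) ≤ (8 * (k + 1) + e) ^ 2 := by nlinarith
    have := Nat.mul_le_mul_left (k + 1) hx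
    linarith
  have hs : 8 * (k + 1) + e - 2 * k = 6 * k + 8 + e := by omega
  rw [hs] at h3
  have hk : 1 ≤ k := by omega
  have h4 : 16 * L * k ≤ (8 * (k + 1) + e) * k := Nat.mul_le_mul_right _ hL
  nlinarith

end CubeLike

end CubeLike

section Containers

open Finset

variable {V : Type*} [DecidableEq V]

/-- The six-step neighbourhood of `x` with respect to `N`. -/
def nbSix (N : V → Finset V) (x : V) : Finset V :=
  ((nbTwo N x).biUnion (nbTwo N)).biUnion (nbTwo N)

lemma mem_nbSix {N : V → Finset V} {x y : V} :
    y ∈ nbSix N x ↔ ∃ a b, a ∈ nbTwo N x ∧ b ∈ nbTwo N a ∧ y ∈ nbTwo N b := by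
  simp only [nbSix, mem_biUnion]
  constructor
  · rintro ⟨b, ⟨a, ha, hb⟩, hy⟩; exact ⟨a, b, ha, hb, hy⟩
  · rintro ⟨a, b, ha, hb, hy⟩; exact ⟨b, ⟨a, ha, hb⟩, hy⟩

lemma mem_nbSix_symm {N : V → Finset V} (hN : ∀ x y, y ∈ N x → x ∈ N y) (x y : V)
    (h : y ∈ nbSix N x) : x ∈ nbSix N y := by
  obtain ⟨a, b, ha, hb, hy⟩ := mem_nbSix.1 h
  exact mem_nbSix.2 ⟨b, a, mem_nbTwo_symm hN _ _ hy, mem_nbTwo_symm hN _ _ hb,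
    mem_nbTwo_symm hN _ _ ha⟩

lemma exists_core (N : V → Finset V) (ψ : ℕ) {A : Finset V} {v : V} (hv : v ∈ A) :
    ∃ U ⊆ A, v ∈ U ∧ ψ * U.card ≤ (U.biUnion N).card + ψ ∧
      ∀ u ∈ A, (N u \ U.biUnion N).card ≤ ψ := by
  obtain ⟨U, hU, hmax⟩ := exists_max_image
    (A.powerset.filter fun U => v ∈ U ∧ ψ * U.card ≤ (U.biUnion N).card + ψ) card
    ⟨{v}, by simp [hv]⟩
  simp only [mem_filter, mem_powerset] at hU hmax
  refine ⟨U, hU.1, hU.2.1, hU.2.2, fun u hu => ?_⟩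
  by_contra! hlt
  have huU : u ∉ U := by
    intro h
    rw [sdiff_eq_empty_iff_subset.2 (subset_biUnion_of_mem N h)] at hlt
    simp at hlt
  have hcard : ((insert u U).biUnion N).card = (N u \ U.biUnion N).card + (U.biUnion N).card := by
    rw [biUnion_insert, card_sdiff_add_card]
  have := hmax (insert u U) ⟨insert_subset hu hU.1, mem_insert_of_mem hU.2.1, by
    rw [hcard, card_insert_of_notMem huU]
    linarith [hU.2.2]⟩
  rw [card_insert_of_notMem huU] at this
  omega

lemma exists_removal {N : V → Finset V} (hN : ∀ x y, y ∈ N x → x ∈ N y) (ψ : ℕ)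
    (S G : Finset V) :
    ∃ W ⊆ S.biUnion N, Disjoint W G ∧ ψ * W.card ≤ (S ∩ W.biUnion N).card ∧
      ∀ w ∉ G, (N w ∩ (S \ W.biUnion N)).card ≤ ψ := by
  obtain ⟨W, hW, hmax⟩ := exists_max_image
    ((S.biUnion N).powerset.filter fun W => Disjoint W G ∧
      ψ * W.card ≤ (S ∩ W.biUnion N).card) card ⟨∅, by simp⟩
  simp only [mem_filter, mem_powerset] at hW hmax
  refine ⟨W, hW.1, hW.2.1, hW.2.2, fun w hw => ?_⟩
  by_contra! hlt
  have hwW : w ∉ W := by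
    intro h
    have : N w ∩ (S \ W.biUnion N) = ∅ := by
      rw [← disjoint_iff_inter_eq_empty, disjoint_right]
      intro z hz hz'
      exact (mem_sdiff.1 hz).2 (mem_biUnion.2 ⟨w, h, hz'⟩)
    rw [this] at hlt
    simp at hlt
  have hwS : w ∈ S.biUnion N := by
    obtain ⟨z, hz⟩ := card_pos.1 (Nat.zero_lt_of_lt hlt)
    rw [mem_inter, mem_sdiff] at hz
    exact mem_biUnion.2 ⟨z, hz.2.1, hN _ _ hz.1⟩
  have hcard : (S ∩ (insert w W).biUnion N).card =
      (N w ∩ (S \ W.biUnion N)).card + (S ∩ W.biUnion N).card := by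
    rw [← card_union_of_disjoint]
    · congr 1
      ext z
      simp only [biUnion_insert, mem_inter, mem_union, mem_sdiff]
      tauto
    · rw [disjoint_left]
      intro z hz hz'
      exact (mem_sdiff.1 (mem_inter.1 hz).2).2 (mem_inter.1 hz').2
  have := hmax (insert w W) ⟨insert_subset hwS hW.1, by
    rw [disjoint_insert_left]; exact ⟨hw, hW.2.1⟩, by
    rw [hcard, card_insert_of_notMem hwW]
    linarith [hW.2.2]⟩
  rw [card_insert_of_notMem hwW] at this
  omega

lemma linkedFrom_nbSix_of_dominating {N : V → Finset V} (hN : ∀ x y, y ∈ N x → x ∈ N y)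
    (hne : ∀ x, (N x).Nonempty) {v : V} {A U : Finset V} (hA : LinkedFrom (nbTwo N) v A)
    (hUA : U ⊆ A) (hv : v ∈ U) (hdom : ∀ y ∈ A, ∃ u ∈ U, u ∈ nbTwo N y) :
    LinkedFrom (nbSix N) v U := by
  have hrefl : ∀ x, x ∈ nbTwo N x := fun x => by
    obtain ⟨z, hz⟩ := hne x
    exact mem_nbTwo.2 ⟨z, hz, hN _ _ hz⟩
  have key : ∀ y, Relation.ReflTransGen (fun a b => b ∈ A ∧ b ∈ nbTwo N a) v y →
      y ∈ A ∧ ∀ u ∈ U, u ∈ nbTwo N y →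
        Relation.ReflTransGen (fun a b => b ∈ U ∧ b ∈ nbSix N a) v u := by
    intro y hy
    induction hy with
    | refl =>
      exact ⟨hA.1, fun u hu huv => .single ⟨hu, mem_nbSix.2 ⟨v, v, hrefl v, hrefl v, huv⟩⟩⟩
    | tail _ hbc ih =>
      refine ⟨hbc.1, fun u hu huc => ?_⟩
      obtain ⟨u', hu', hub⟩ := hdom _ ih.1
      exact (ih.2 u' hu' hub).tail
        ⟨hu, mem_nbSix.2 ⟨_, _, mem_nbTwo_symm hN _ _ hub, hbc.2, huc⟩⟩
  exact ⟨hv, fun u hu => (key u (hA.2 u (hUA hu))).2 u hu (hrefl u)⟩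

variable [Fintype V]

/-- The vertices with at most `ψ` neighbours outside `N(U)`. -/
def outerApprox (N : V → Finset V) (ψ : ℕ) (U : Finset V) : Finset V :=
  univ.filter fun u => (N u \ U.biUnion N).card ≤ ψ

/-- The outer approximation with the neighbourhood of `W` removed. -/
def refinedOuter (N : V → Finset V) (ψ : ℕ) (U W : Finset V) : Finset V :=
  outerApprox N ψ U \ W.biUnion N

/-- `N(U)` together with the vertices with more than `ψ` neighbours in `refinedOuter N ψ U W`. -/
def refinedInner (N : V → Finset V) (ψ : ℕ) (U W : Finset V) : Finset V :=
  U.biUnion N ∪ univ.filter fun w => ψ < (N w ∩ refinedOuter N ψ U W).card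

lemma linkedFrom_interiorOf {N : V → Finset V} (hN : ∀ x y, y ∈ N x → x ∈ N y)
    (hne : ∀ x, (N x).Nonempty) {v : V} {C : Finset V} (hC : LinkedFrom (nbTwo N) v C) :
    LinkedFrom (nbTwo N) v (interiorOf N (C.biUnion N)) := by
  have hsub := subset_interiorOf_biUnion N C
  refine ⟨hsub hC.1, fun y hy => ?_⟩
  obtain ⟨z, hz⟩ := hne y
  obtain ⟨c, hc, hzc⟩ := mem_biUnion.1 (mem_interiorOf.1 hy hz)
  have hle : (fun a b => b ∈ C ∧ b ∈ nbTwo N a) ≤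
      fun a b => b ∈ interiorOf N (C.biUnion N) ∧ b ∈ nbTwo N a :=
    fun _ _ h => ⟨hsub h.1, h.2⟩
  exact (Relation.ReflTransGen.mono hle _ _ (hC.2 c hc)).tail
    ⟨hy, mem_nbTwo.2 ⟨z, hzc, hN _ _ hz⟩⟩

namespace CubeLike

variable {N : V → Finset V} {d : ℕ}

lemma nbr_nonempty (h : CubeLike N d) (hd : 0 < d) (x : V) : (N x).Nonempty :=
  card_pos.1 (by rw [h.card_nbr]; exact hd)

lemma mem_nbTwo_self (h : CubeLike N d) (hd : 0 < d) (x : V) : x ∈ nbTwo N x := by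
  obtain ⟨z, hz⟩ := h.nbr_nonempty hd x
  exact mem_nbTwo.2 ⟨z, hz, h.symm _ _ hz⟩

lemma mem_nbSix_self (h : CubeLike N d) (hd : 0 < d) (x : V) : x ∈ nbSix N x :=
  mem_nbSix.2 ⟨x, x, h.mem_nbTwo_self hd x, h.mem_nbTwo_self hd x, h.mem_nbTwo_self hd x⟩

lemma card_nbTwo_le (h : CubeLike N d) (x : V) : (nbTwo N x).card ≤ d ^ 2 := by
  rw [sq]
  exact (h.card_biUnion_le _).trans_eq (by rw [h.card_nbr])

lemma card_nbSix_le (h : CubeLike N d) (x : V) : (nbSix N x).card ≤ d ^ 6 := by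
  have h1 : ((nbTwo N x).biUnion (nbTwo N)).card ≤ d ^ 2 * d ^ 2 :=
    (card_biUnion_le_card_mul _ _ _ fun y _ => h.card_nbTwo_le y).trans
      (Nat.mul_le_mul_right _ (h.card_nbTwo_le x))
  calc (nbSix N x).card ≤ d ^ 2 * d ^ 2 * d ^ 2 :=
        (card_biUnion_le_card_mul _ _ _ fun y _ => h.card_nbTwo_le y).trans
          (Nat.mul_le_mul_right _ h1)
    _ = d ^ 6 := by ring

lemma card_interiorOf_le (h : CubeLike N d) (hd : 0 < d) (C : Finset V) :
    (interiorOf N (C.biUnion N)).card ≤ (C.biUnion N).card := by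
  set A := interiorOf N (C.biUnion N)
  have h1 := h.sum_card_nbr_inter_biUnion A subset_rfl (biUnion_interiorOf_biUnion N C).subset
  refine Nat.le_of_mul_le_mul_left ?_ hd
  rw [← h1, mul_comm, ← smul_eq_mul]
  refine sum_le_card_nsmul _ _ _ fun z _ => ?_
  exact (card_le_card inter_subset_left).trans_eq (h.card_nbr z)

/-- A superset of `interiorOf N G` in which every vertex has at least half of its neighbours in
`G` exceeds it by at most twice the deficit. -/
lemma card_sdiff_interiorOf_le (h : CubeLike N d) (hd : 0 < d) {C S : Finset V}
    (hS : ∀ u ∈ S, d ≤ 2 * (N u ∩ C.biUnion N).card) :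
    (S \ interiorOf N (C.biUnion N)).card ≤
      2 * ((C.biUnion N).card - (interiorOf N (C.biUnion N)).card) := by
  set A := interiorOf N (C.biUnion N)
  set G := C.biUnion N
  have h1 : ∑ z ∈ G, (N z ∩ A).card = d * A.card :=
    h.sum_card_nbr_inter_biUnion A subset_rfl (biUnion_interiorOf_biUnion N C).subset
  have h2 : ∑ z ∈ G, (N z ∩ (S \ A)).card + ∑ z ∈ G, (N z ∩ A).card ≤ G.card * d := by
    rw [← sum_add_distrib, ← smul_eq_mul]
    refine sum_le_card_nsmul _ _ _ fun z _ => ?_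
    rw [← h.card_nbr z, ← card_union_of_disjoint]
    · exact card_le_card (union_subset inter_subset_left inter_subset_left)
    · rw [disjoint_left]
      intro w hw hw'
      exact (mem_sdiff.1 (mem_inter.1 hw).2).2 (mem_inter.1 hw').2
  have h3 : (S \ A).card * d ≤ 2 * ∑ z ∈ G, (N z ∩ (S \ A)).card := by
    rw [← sum_card_nbr_inter_comm h.symm, mul_sum, ← smul_eq_mul]
    exact card_nsmul_le_sum _ _ _ fun u hu => hS u (mem_sdiff.1 hu).1
  refine Nat.le_of_mul_le_mul_right (h3.trans ?_) hd
  rw [Nat.mul_assoc, Nat.sub_mul]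
  have : A.card * d = d * A.card := mul_comm _ _
  omega

/-- The approximation of a linked set by two small sets `U` and `W`. -/
theorem exists_container (h : CubeLike N d) (hd : 0 < d) {ψ : ℕ} (hψ : 0 < ψ) (hψd : 2 * ψ ≤ d)
    {v : V} {C : Finset V} (hC : LinkedFrom (nbTwo N) v C) {a g : ℕ}
    (hg : (C.biUnion N).card = g) (ha : (interiorOf N (C.biUnion N)).card = a) :
    ∃ U W : Finset V, LinkedFrom (nbSix N) v U ∧ U.card ≤ g / ψ + 1 ∧
      (outerApprox N ψ U).card ≤ 2 * g ∧
      W ⊆ (outerApprox N ψ U).biUnion N ∧ W.card ≤ 2 * (g - a) / ψ ∧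
      C ⊆ refinedOuter N ψ U W ∧ refinedInner N ψ U W ⊆ C.biUnion N ∧
      C.biUnion N \ refinedInner N ψ U W ⊆ (outerApprox N ψ U).biUnion N ∧
      d * (refinedOuter N ψ U W).card ≤ d * (refinedInner N ψ U W).card +
        ψ * (C.biUnion N \ refinedInner N ψ U W).card + ψ * (2 * (g - a)) := by
  set G := C.biUnion N
  set A := interiorOf N G
  have hlink : LinkedFrom (nbTwo N) v A := linkedFrom_interiorOf h.symm (h.nbr_nonempty hd) hC
  have hAG : A.biUnion N = G := biUnion_interiorOf_biUnion N C
  have hCA : C ⊆ A := subset_interiorOf_biUnion N C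
  have hag : a ≤ g := by rw [← hg, ← ha]; exact h.card_interiorOf_le hd C
  obtain ⟨U, hUA, hvU, hUcard, hU⟩ := exists_core N ψ hlink.1
  set S := outerApprox N ψ U with hS
  have hUG : U.biUnion N ⊆ G := by
    rw [← hAG]; exact biUnion_subset_biUnion_of_subset_left _ hUA
  have hmemS : ∀ u, u ∈ S ↔ (N u \ U.biUnion N).card ≤ ψ := fun u => by simp [hS, outerApprox]
  have hAS : A ⊆ S := fun u hu => (hmemS u).2 (hU u hu)
  obtain ⟨W, hWS, hWG, hWcard, hW⟩ := exists_removal h.symm ψ S G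
  set R := refinedOuter N ψ U W with hR
  set F := refinedInner N ψ U W with hF
  have hRS : R ⊆ S := sdiff_subset
  have hAR : A ⊆ R := by
    intro u hu
    refine mem_sdiff.2 ⟨hAS hu, fun hu' => ?_⟩
    obtain ⟨w, hw, huw⟩ := mem_biUnion.1 hu'
    exact disjoint_left.1 hWG hw (mem_interiorOf.1 hu (h.symm _ _ huw))
  have hFG : F ⊆ G := by
    refine union_subset hUG fun w hw => ?_
    by_contra hwG
    have := hW w hwG
    rw [mem_filter] at hw
    exact absurd hw.2 (not_lt.2 this)
  have hUF : U.biUnion N ⊆ F := subset_union_left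
  have hFmem : ∀ w ∉ F, (N w ∩ R).card ≤ ψ := by
    intro w hw
    by_contra! hlt
    exact hw (mem_union_right _ (mem_filter.2 ⟨mem_univ _, hlt⟩))
  have hSdiff : (S \ A).card ≤ 2 * (g - a) := by
    rw [← hg, ← ha]
    refine h.card_sdiff_interiorOf_le hd fun u hu => ?_
    have h1 := (hmemS u).1 hu
    have h2 : (N u ∩ U.biUnion N).card ≤ (N u ∩ G).card :=
      card_le_card (inter_subset_inter_left hUG)
    have h3 := card_sdiff_add_card_inter (N u) (U.biUnion N)
    rw [h.card_nbr] at h3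
    change d ≤ 2 * (N u ∩ G).card
    omega
  refine ⟨U, W, ?_, ?_, ?_, hWS, ?_, hCA.trans hAR, hFG, ?_, ?_⟩
  · refine linkedFrom_nbSix_of_dominating h.symm (h.nbr_nonempty hd) hlink hUA hvU fun y hy => ?_
    have h1 := hU y hy
    have h3 := card_sdiff_add_card_inter (N y) (U.biUnion N)
    rw [h.card_nbr] at h3
    obtain ⟨z, hz⟩ := card_pos.1 (show 0 < (N y ∩ U.biUnion N).card by omega)
    rw [mem_inter] at hz
    obtain ⟨u, hu, hzu⟩ := mem_biUnion.1 hz.2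
    exact ⟨u, hu, mem_nbTwo.2 ⟨z, hz.1, h.symm _ _ hzu⟩⟩
  · have h1 : (U.biUnion N).card ≤ g := hg ▸ card_le_card hUG
    rw [← Nat.sub_le_iff_le_add, Nat.le_div_iff_mul_le hψ, Nat.sub_mul, mul_comm, one_mul]
    omega
  · have := card_sdiff_add_card_eq_card hAS
    change S.card ≤ 2 * g
    omega
  · rw [Nat.le_div_iff_mul_le hψ, mul_comm]
    refine hWcard.trans ((card_le_card ?_).trans hSdiff)
    intro z hz
    rw [mem_inter] at hz
    exact mem_sdiff.2 ⟨hz.1, fun hzA => (mem_sdiff.1 (hAR hzA)).2 hz.2⟩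
  · refine sdiff_subset.trans ?_
    rw [← hAG]
    exact biUnion_subset_biUnion_of_subset_left _ hAS
  · have e1 : d * R.card = ∑ u ∈ R, (N u ∩ F).card + ∑ u ∈ R, (N u \ F).card := by
      rw [← sum_add_distrib, mul_comm, ← smul_eq_mul, ← sum_const]
      refine sum_congr rfl fun u _ => ?_
      rw [add_comm, card_sdiff_add_card_inter, h.card_nbr]
    have e2 : ∑ u ∈ R, (N u ∩ F).card ≤ d * F.card := by
      rw [sum_card_nbr_inter_comm h.symm, mul_comm, ← smul_eq_mul]
      exact sum_le_card_nsmul _ _ _ fun z _ =>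
        (card_le_card inter_subset_left).trans_eq (h.card_nbr z)
    have e3 : ∑ u ∈ R, (N u \ F).card = ∑ u ∈ R \ A, (N u \ F).card + ∑ u ∈ A, (N u \ F).card :=
      (sum_sdiff hAR).symm
    have e4 : ∑ u ∈ R \ A, (N u \ F).card ≤ ψ * (2 * (g - a)) := by
      refine (sum_le_card_nsmul _ _ ψ fun u hu => ?_).trans ?_
      · exact (card_le_card (sdiff_subset_sdiff subset_rfl hUF)).trans
          ((hmemS u).1 (hRS (mem_sdiff.1 hu).1))
      · rw [smul_eq_mul, mul_comm]
        exact Nat.mul_le_mul_left _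
          ((card_le_card (sdiff_subset_sdiff hRS subset_rfl)).trans hSdiff)
    have e5 : ∑ u ∈ A, (N u \ F).card ≤ ψ * (G \ F).card := by
      calc ∑ u ∈ A, (N u \ F).card = ∑ u ∈ A, (N u ∩ (G \ F)).card := by
            refine sum_congr rfl fun u hu => ?_
            rw [← inter_sdiff_assoc, inter_eq_left.2 (mem_interiorOf.1 hu)]
        _ = ∑ z ∈ G \ F, (N z ∩ A).card := sum_card_nbr_inter_comm h.symm _ _
        _ ≤ ψ * (G \ F).card := by
            rw [mul_comm, ← smul_eq_mul]
            refine sum_le_card_nsmul _ _ _ fun z hz => ?_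
            exact (card_le_card (inter_subset_inter_left hAR)).trans
              (hFmem z (mem_sdiff.1 hz).2)
    change d * R.card ≤ d * F.card + ψ * (G \ F).card + ψ * (2 * (g - a))
    omega

end CubeLike

end Containers

section Counting

open Finset

lemma card_biUnion_le_mul_real {α β : Type*} [DecidableEq β] {s : Finset α} {f : α → Finset β}
    {b : ℝ} (h : ∀ x ∈ s, ((f x).card : ℝ) ≤ b) : ((s.biUnion f).card : ℝ) ≤ s.card * b := by
  calc ((s.biUnion f).card : ℝ) ≤ ∑ x ∈ s, ((f x).card : ℝ) := by exact_mod_cast card_biUnion_le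
    _ ≤ s.card * b := by rw [← nsmul_eq_mul]; exact sum_le_card_nsmul _ _ _ h

lemma card_filter_powerset_le_exp {V : Type*} (Y : Finset V) {q : ℝ} (hq : 0 ≤ q) (k : ℝ) :
    ((Y.powerset.filter fun X => (X.card : ℝ) ≤ k).card : ℝ) ≤
      Real.exp (q * k + Y.card * Real.exp (-q)) := by
  have h1 : ((Y.powerset.filter fun X => (X.card : ℝ) ≤ k).card : ℝ) * Real.exp (-(q * k)) ≤
      (Real.exp (-q) + 1) ^ Y.card := by
    rw [← sum_pow_mul_eq_add_pow, ← nsmul_eq_mul]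
    refine (card_nsmul_le_sum _ (fun X => Real.exp (-q) ^ X.card * 1 ^ (Y.card - X.card)) _
      fun X hX => ?_).trans (sum_le_sum_of_subset_of_nonneg (filter_subset _ _)
        fun _ _ _ => by positivity)
    rw [one_pow, mul_one, ← Real.exp_nat_mul]
    refine Real.exp_le_exp.2 ?_
    have := mul_le_mul_of_nonneg_left (mem_filter.1 hX).2 hq
    linarith
  have h2 : (Real.exp (-q) + 1) ^ Y.card ≤ Real.exp (Y.card * Real.exp (-q)) := by
    rw [Real.exp_nat_mul]
    gcongr
    exact Real.add_one_le_exp _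
  calc _ = _ * Real.exp (-(q * k)) * Real.exp (q * k) := by
        rw [mul_assoc, ← Real.exp_add, neg_add_cancel, Real.exp_zero, mul_one]
    _ ≤ Real.exp (Y.card * Real.exp (-q)) * Real.exp (q * k) := by
        gcongr
        exact h1.trans h2
    _ = _ := by rw [← Real.exp_add, add_comm]

namespace CubeLike

variable {V : Type*} [DecidableEq V] [Fintype V] {N : V → Finset V} {d : ℕ}

open Classical in
theorem card_linkedFrom_le (h : CubeLike N d) (hd : 0 < d) {L ψ : ℕ} (hL : 0 < L)
    (hdL : (d : ℝ) ≤ Real.exp L) (hψ : 0 < ψ) (hψd : 128 * L * ψ ≤ d) (v : V) (g a : ℕ) :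
    ((univ.filter fun C : Finset V => LinkedFrom (nbTwo N) v C ∧ (C.biUnion N).card = g ∧
      (interiorOf N (C.biUnion N)).card = a).card : ℝ) ≤
      2 ^ g * (2 * Real.exp (20 * L * g / ψ + 8 * g / d ^ 3 - ((g : ℝ) - a) / (128 * L))) := by
  set 𝒞 := univ.filter fun C : Finset V => LinkedFrom (nbTwo N) v C ∧ (C.biUnion N).card = g ∧
      (interiorOf N (C.biUnion N)).card = a with h𝒞
  rcases 𝒞.eq_empty_or_nonempty with h0 | ⟨C₀, hC₀⟩
  · rw [h0]; simp only [card_empty, Nat.cast_zero]; positivity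
  have hag : a ≤ g := by
    rw [h𝒞, mem_filter] at hC₀
    rw [← hC₀.2.2.1, ← hC₀.2.2.2]
    exact h.card_interiorOf_le hd C₀
  have hψ2 : 2 * ψ ≤ d := by nlinarith
  set t := g - a with ht
  have htR : (t : ℝ) = g - a := by rw [ht, Nat.cast_sub hag]
  have hLR : (0 : ℝ) < L := by exact_mod_cast hL
  have hdR : (0 : ℝ) < d := by exact_mod_cast hd
  have hψR : (0 : ℝ) < ψ := by exact_mod_cast hψ
  let 𝒰 := (walkSets (nbSix N) (2 * (g / ψ)) v).filter fun U => (outerApprox N ψ U).card ≤ 2 * g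
  let Y : Finset V → Finset V := fun U => (outerApprox N ψ U).biUnion N
  let 𝒲 : Finset V → Finset (Finset V) := fun U =>
    (Y U).powerset.filter fun W => (W.card : ℝ) ≤ 2 * t / ψ
  let 𝒳 : Finset V → Finset (Finset V) := fun U =>
    (Y U).powerset.filter fun X => (X.card : ℝ) ≤ t / (16 * L)
  let I : Finset V → Finset V → Finset V → Finset V := fun U W X =>
    interiorOf N (refinedInner N ψ U W ∪ X)
  let 𝒟₁ : Finset V → Finset V → Finset (Finset V) := fun U W =>
    if 64 * L * (refinedOuter N ψ U W).card + t ≤ 64 * L * g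
      then (refinedOuter N ψ U W).powerset else ∅
  let 𝒟₂ : Finset V → Finset V → Finset V → Finset (Finset V) := fun U W X =>
    if (I U W X).card ≤ a then (I U W X).powerset else ∅
  have hsub : 𝒞 ⊆ 𝒰.biUnion fun U => (𝒲 U).biUnion fun W =>
      𝒟₁ U W ∪ (𝒳 U).biUnion fun X => 𝒟₂ U W X := by
    intro C hC
    rw [h𝒞, mem_filter] at hC
    obtain ⟨-, hC, hCg, hCa⟩ := hC
    obtain ⟨U, W, hU, hUc, hUo, hWs, hWc, hCR, hFG, hGF, hin⟩ :=
      h.exists_container hd hψ hψ2 hC hCg hCa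
    rw [mem_biUnion]
    refine ⟨U, mem_filter.2 ⟨hU.mem_walkSets (h.mem_nbSix_self hd)
      (mem_nbSix_symm h.symm) hUc, hUo⟩, ?_⟩
    rw [mem_biUnion]
    refine ⟨W, mem_filter.2 ⟨mem_powerset.2 hWs, ?_⟩, ?_⟩
    · rw [le_div_iff₀ hψR]
      exact_mod_cast (Nat.le_div_iff_mul_le hψ).1 hWc
    rw [mem_union]
    set R := refinedOuter N ψ U W
    set F := refinedInner N ψ U W
    set G := C.biUnion N
    by_cases hy : 16 * L * (G \ F).card ≤ t
    · right
      rw [mem_biUnion]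
      have hFX : F ∪ G \ F = G := union_sdiff_of_subset hFG
      refine ⟨G \ F, mem_filter.2 ⟨mem_powerset.2 hGF, ?_⟩, ?_⟩
      · rw [le_div_iff₀ (by positivity), mul_comm]
        exact_mod_cast hy
      · have hI : I U W (G \ F) = interiorOf N G := by
          change interiorOf N (F ∪ G \ F) = _
          rw [hFX]
        simp only [𝒟₂, hI]
        rw [if_pos hCa.le, mem_powerset]
        exact subset_interiorOf_biUnion N C
    · left
      have key : 64 * L * R.card + t ≤ 64 * L * g := by
        have h1 : (G \ F).card + F.card = g := by
          rw [card_sdiff_add_card_eq_card hFG, hCg]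
        rw [not_le] at hy
        have hy' : (t : ℝ) ≤ 16 * L * (G \ F).card := by exact_mod_cast hy.le
        have h1' : ((G \ F).card : ℝ) + F.card = g := by exact_mod_cast h1
        have hin' : (d : ℝ) * R.card ≤ d * F.card + ψ * (G \ F).card + ψ * (2 * t) := by
          exact_mod_cast hin
        have hψd' : 128 * (L : ℝ) * ψ ≤ d := by exact_mod_cast hψd
        have hL1 : (1 : ℝ) ≤ L := by exact_mod_cast hL
        have hy0 : (0 : ℝ) ≤ (G \ F).card := by positivity
        have ht0 : (0 : ℝ) ≤ t := by positivity
        have key' : (d : ℝ) * (64 * L * R.card + t) ≤ d * (64 * L * g) := by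
          have e1 : 64 * (L : ℝ) * (d * R.card) ≤
              64 * L * (d * F.card + ψ * (G \ F).card + ψ * (2 * t)) := by gcongr
          have e2 : (128 * (L : ℝ) * ψ) * t ≤ d * t := by gcongr
          have e3 : (128 * (L : ℝ) * ψ) * (G \ F).card ≤ d * (G \ F).card := by gcongr
          have e4 : (d : ℝ) * t ≤ d * (16 * L * (G \ F).card) := by gcongr
          have e5 : (d : ℝ) * (G \ F).card * 1 ≤ d * (G \ F).card * L := by gcongr
          rw [← h1']
          nlinarith
        exact_mod_cast le_of_mul_le_mul_left key' hdR
      simp only [𝒟₁]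
      rw [if_pos key, mem_powerset]
      exact hCR
  have hY : ∀ U ∈ 𝒰, ((Y U).card : ℝ) * Real.exp (-(4 * L)) ≤ 2 * g / d ^ 3 := by
    intro U hU
    have h1 : ((Y U).card : ℝ) ≤ 2 * g * d := by
      exact_mod_cast (h.card_biUnion_le _).trans (Nat.mul_le_mul_right _ (mem_filter.1 hU).2)
    have h2 : Real.exp (-(4 * L)) ≤ 1 / d ^ 4 := by
      rw [Real.exp_neg, ← one_div]
      refine one_div_le_one_div_of_le (by positivity) ?_
      calc (d : ℝ) ^ 4 ≤ Real.exp L ^ 4 := by gcongr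
        _ = Real.exp (4 * L) := by rw [← Real.exp_nat_mul]; norm_num
    calc ((Y U).card : ℝ) * Real.exp (-(4 * L)) ≤ (2 * g * d) * (1 / d ^ 4) := by gcongr
      _ = 2 * g / d ^ 3 := by field_simp
  have hq : (0 : ℝ) ≤ 4 * L := by positivity
  have h𝒰c : (𝒰.card : ℝ) ≤ Real.exp (12 * L * g / ψ) := by
    have h1 : 𝒰.card ≤ (d ^ 6) ^ (2 * (g / ψ)) :=
      (card_filter_le _ _).trans (card_walkSets_le h.card_nbSix_le _ _)
    have h2 : ((g / ψ : ℕ) : ℝ) ≤ g / ψ := Nat.cast_div_le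
    calc (𝒰.card : ℝ) ≤ ((d : ℝ) ^ 6) ^ (2 * (g / ψ)) := by exact_mod_cast h1
      _ ≤ (Real.exp L ^ 6) ^ (2 * (g / ψ)) := by gcongr
      _ = Real.exp (12 * L * (g / ψ : ℕ)) := by
          rw [← pow_mul, ← Real.exp_nat_mul]; push_cast; ring_nf
      _ ≤ Real.exp (12 * L * (g / ψ)) := by gcongr
      _ = _ := by ring_nf
  have h𝒲c : ∀ U ∈ 𝒰, ((𝒲 U).card : ℝ) ≤ Real.exp (8 * L * t / ψ + 2 * g / d ^ 3) := by
    intro U hU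
    refine (card_filter_powerset_le_exp (Y U) hq _).trans (Real.exp_le_exp.2 ?_)
    have := hY U hU
    have e : 4 * (L : ℝ) * (2 * t / ψ) = 8 * L * t / ψ := by ring
    linarith
  have h𝒳c : ∀ U ∈ 𝒰, ((𝒳 U).card : ℝ) ≤ Real.exp (t / 4 + 2 * g / d ^ 3) := by
    intro U hU
    refine (card_filter_powerset_le_exp (Y U) hq _).trans (Real.exp_le_exp.2 ?_)
    have := hY U hU
    have e : 4 * (L : ℝ) * (t / (16 * L)) = t / 4 := by field_simp; ring
    linarith
  have hlog : Real.exp (1 / 2) ≤ 2 := by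
    rw [← Real.le_log_iff_exp_le (by norm_num)]
    linarith [Real.log_two_gt_d9]
  have h𝒟₁ : ∀ U W, ((𝒟₁ U W).card : ℝ) ≤ 2 ^ g * Real.exp (-(t / (128 * L))) := by
    intro U W
    simp only [𝒟₁]
    split_ifs with hs
    · rw [card_powerset]
      set s := (refinedOuter N ψ U W).card
      have hsg : s ≤ g :=
        Nat.le_of_mul_le_mul_left (show 64 * L * s ≤ 64 * L * g by omega) (by positivity)
      have h1 : Real.exp (t / (128 * L)) ≤ 2 ^ (g - s) := by
        calc Real.exp (t / (128 * L)) ≤ Real.exp ((g - s : ℕ) * (1 / 2)) := by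
              refine Real.exp_le_exp.2 ?_
              rw [div_le_iff₀ (by positivity), Nat.cast_sub hsg]
              have : 64 * (L : ℝ) * s + t ≤ 64 * L * g := by exact_mod_cast hs
              nlinarith
          _ ≤ 2 ^ (g - s) := by rw [Real.exp_nat_mul]; gcongr
      rw [Real.exp_neg, ← div_eq_mul_inv, le_div_iff₀ (Real.exp_pos _)]
      calc ((2 ^ s : ℕ) : ℝ) * Real.exp (t / (128 * L)) ≤ 2 ^ s * 2 ^ (g - s) := by
            push_cast; gcongr
        _ = 2 ^ g := by rw [← pow_add, Nat.add_sub_cancel' hsg]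
    · simp only [card_empty, Nat.cast_zero]; positivity
  have h𝒟₂ : ∀ U W X, ((𝒟₂ U W X).card : ℝ) ≤ 2 ^ g * Real.exp (-(t / 2)) := by
    intro U W X
    simp only [𝒟₂]
    split_ifs with hs
    · rw [card_powerset]
      have h1 : Real.exp (t / 2) ≤ 2 ^ t := by
        calc Real.exp (t / 2) = Real.exp (1 / 2) ^ t := by rw [← Real.exp_nat_mul]; ring_nf
          _ ≤ 2 ^ t := by gcongr
      rw [Real.exp_neg, ← div_eq_mul_inv, le_div_iff₀ (Real.exp_pos _)]
      calc ((2 ^ (I U W X).card : ℕ) : ℝ) * Real.exp (t / 2) ≤ 2 ^ a * 2 ^ t := by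
            push_cast; gcongr; norm_num
        _ = 2 ^ g := by rw [← pow_add, ht, Nat.add_sub_cancel' hag]
    · simp only [card_empty, Nat.cast_zero]; positivity
  have h𝒟 : ∀ U ∈ 𝒰, ∀ W ∈ 𝒲 U, ((𝒟₁ U W ∪ (𝒳 U).biUnion fun X => 𝒟₂ U W X).card : ℝ) ≤
      2 ^ g * (2 * Real.exp (2 * g / d ^ 3 - t / (128 * L))) := by
    intro U hU W _
    have h1 : (((𝒳 U).biUnion fun X => 𝒟₂ U W X).card : ℝ) ≤
        2 ^ g * Real.exp (2 * g / d ^ 3 - t / (128 * L)) := by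
      refine (card_biUnion_le_mul_real fun X _ => h𝒟₂ U W X).trans ?_
      calc ((𝒳 U).card : ℝ) * (2 ^ g * Real.exp (-(t / 2)))
          ≤ Real.exp (t / 4 + 2 * g / d ^ 3) * (2 ^ g * Real.exp (-(t / 2))) := by
            gcongr; exact h𝒳c U hU
        _ = 2 ^ g * Real.exp (2 * g / d ^ 3 - t / 4) := by
            rw [mul_left_comm, ← Real.exp_add]; ring_nf
        _ ≤ _ := by
            gcongr
            have : (1 : ℝ) ≤ L := by exact_mod_cast hL
            linarith
    have h2 : ((𝒟₁ U W).card : ℝ) ≤ 2 ^ g * Real.exp (2 * g / d ^ 3 - t / (128 * L)) := by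
      refine (h𝒟₁ U W).trans ?_
      gcongr
      have : (0 : ℝ) ≤ 2 * g / d ^ 3 := by positivity
      linarith
    have h3 : ((𝒟₁ U W ∪ (𝒳 U).biUnion fun X => 𝒟₂ U W X).card : ℝ) ≤
        (𝒟₁ U W).card + ((𝒳 U).biUnion fun X => 𝒟₂ U W X).card := by
      exact_mod_cast card_union_le _ _
    linarith
  calc (𝒞.card : ℝ) ≤ _ := Nat.cast_le.2 (card_le_card hsub)
    _ ≤ 𝒰.card * (Real.exp (8 * L * t / ψ + 2 * g / d ^ 3) *
          (2 ^ g * (2 * Real.exp (2 * g / d ^ 3 - t / (128 * L))))) := by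
        refine card_biUnion_le_mul_real fun U hU => ?_
        refine (card_biUnion_le_mul_real (h𝒟 U hU)).trans ?_
        gcongr
        exact h𝒲c U hU
    _ ≤ Real.exp (12 * L * g / ψ) * (Real.exp (8 * L * t / ψ + 2 * g / d ^ 3) *
          (2 ^ g * (2 * Real.exp (2 * g / d ^ 3 - t / (128 * L))))) := by gcongr
    _ = 2 ^ g * (2 * Real.exp (12 * L * g / ψ + (8 * L * t / ψ + 2 * g / d ^ 3) +
          (2 * g / d ^ 3 - t / (128 * L)))) := by
        rw [Real.exp_add (12 * L * g / ψ + _), Real.exp_add (12 * L * g / ψ)]; ring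
    _ ≤ _ := by
        gcongr
        have e1 : (8 * L * t / ψ : ℝ) ≤ 8 * L * g / ψ := by
          have : (t : ℝ) ≤ g := by exact_mod_cast Nat.sub_le g a
          gcongr
        have e2 : (12 * L * g / ψ + 8 * L * g / ψ : ℝ) = 20 * L * g / ψ := by ring
        have e3 : (0 : ℝ) ≤ g / d ^ 3 := by positivity
        have e4 : (2 * g / d ^ 3 : ℝ) = 2 * (g / d ^ 3) := by ring
        have e5 : (8 * g / d ^ 3 : ℝ) = 8 * (g / d ^ 3) := by ring
        rw [← htR, e4, e5]
        linarith

end CubeLike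

end Counting

section LinkedSum

open Finset

lemma exponent_le_neg_five_mul {d g t ψ L r : ℝ} (hr : r ^ 2 = d) (hL : 1 ≤ L)
    (hbig : 10 ^ 8 * L ^ 3 ≤ r) (hψ : 0 < ψ) (hψd : d ≤ 256 * L * ψ) (hg : d ^ 2 ≤ 10 * g)
    (ht : g ≤ 4 * r * t) :
    20 * L * g / ψ + 8 * g / d ^ 3 - t / (128 * L) ≤ -(5 * d) := by
  have hL3 : L ≤ L ^ 3 := le_self_pow₀ hL (by norm_num)
  have hr1 : 1 ≤ r := by nlinarith
  have hr0 : 0 < r := by linarith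
  have hd1 : 1 ≤ d := by nlinarith
  have hL0 : 0 < L := by linarith
  have hg0 : 0 < g := by nlinarith
  have h1 : 20 * L * g / ψ ≤ 5120 * L ^ 2 * g / r ^ 2 := by
    rw [hr, div_le_div_iff₀ hψ (by linarith)]
    have := mul_le_mul_of_nonneg_left hψd (show 0 ≤ 20 * L * g by positivity)
    nlinarith
  have h2 : 8 * g / d ^ 3 ≤ 8 * L ^ 2 * g / r ^ 2 := by
    rw [hr]
    have e1 : d ≤ d ^ 3 := le_self_pow₀ hd1 (by norm_num)
    have e2 : 1 ≤ L ^ 2 := one_le_pow₀ hL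
    have e3 : 8 * g ≤ 8 * L ^ 2 * g := by nlinarith
    gcongr
  have h3 : g / (512 * L * r) ≤ t / (128 * L) := by
    rw [div_le_div_iff₀ (by positivity) (by positivity)]
    have := mul_le_mul_of_nonneg_left ht (show 0 ≤ 128 * L by positivity)
    nlinarith
  have h4 : 5128 * L ^ 2 * g / r ^ 2 ≤ g / (1024 * L * r) := by
    rw [div_le_div_iff₀ (by positivity) (by positivity)]
    have : 5128 * 1024 * L ^ 3 ≤ r := by linarith
    have := mul_le_mul_of_nonneg_left this (show 0 ≤ g * r by positivity)
    nlinarith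
  have h5 : 5 * d ≤ g / (1024 * L * r) := by
    rw [le_div_iff₀ (by positivity)]
    have e1 : 51200 * L ≤ r := by linarith
    have e2 := mul_le_mul_of_nonneg_left e1 (show 0 ≤ r ^ 3 by positivity)
    rw [← hr] at hg ⊢
    nlinarith
  have h6 : g / (512 * L * r) = g / (1024 * L * r) + g / (1024 * L * r) := by
    field_simp; norm_num
  have h7 : 5128 * L ^ 2 * g / r ^ 2 = 5120 * L ^ 2 * g / r ^ 2 + 8 * L ^ 2 * g / r ^ 2 := by
    ring
  linarith

namespace CubeLike

variable {V : Type*} [DecidableEq V] [Fintype V] {N : V → Finset V} {d : ℕ}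

open Classical in
lemma sum_small_linked_le (h : CubeLike N d) {L : ℕ} (hdL : d ≤ 2 ^ L) (hL : 16 * L ≤ d)
    (hd : 0 < d) (v : V) :
    ∑ C with LinkedFrom (nbTwo N) v C ∧ 2 ≤ C.card ∧ 10 * (C.biUnion N).card < d ^ 2,
      (1 / 2 : ℝ) ^ (C.biUnion N).card ≤ d * (1 / 2 : ℝ) ^ (d + d / 2) := by
  set S := univ.filter fun C : Finset V =>
    LinkedFrom (nbTwo N) v C ∧ 2 ≤ C.card ∧ 10 * (C.biUnion N).card < d ^ 2 with hS
  have hmem : ∀ C ∈ S, C.card - 1 ∈ range d := fun C hC => by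
    rw [hS, mem_filter] at hC
    have := h.card_le_of_card_biUnion_lt (card_pos.1 (by omega)) hC.2.2.2
    rw [mem_range]; omega
  rw [← sum_fiberwise_of_maps_to hmem]
  refine (sum_le_card_nsmul _ _ ((1 / 2 : ℝ) ^ (d + d / 2)) fun k hk => ?_).trans_eq
    (by rw [card_range, nsmul_eq_mul])
  have hcard : (S.filter fun C => C.card - 1 = k).card ≤ 2 ^ (4 * L * k) := by
    calc (S.filter fun C => C.card - 1 = k).card ≤ (walkSets (nbTwo N) (2 * k) v).card := by
          refine card_le_card fun C hC => ?_
          rw [mem_filter, hS, mem_filter] at hC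
          exact hC.1.2.1.mem_walkSets (h.mem_nbTwo_self hd) (mem_nbTwo_symm h.symm) (by omega)
      _ ≤ (d ^ 2) ^ (2 * k) := card_walkSets_le h.card_nbTwo_le _ _
      _ ≤ ((2 ^ L) ^ 2) ^ (2 * k) := by gcongr
      _ = 2 ^ (4 * L * k) := by rw [← pow_mul, ← pow_mul]; ring_nf
  calc ∑ C ∈ S with C.card - 1 = k, (1 / 2 : ℝ) ^ (C.biUnion N).card
      ≤ (S.filter fun C => C.card - 1 = k).card • (1 / 2 : ℝ) ^ (4 * L * k + (d + d / 2)) := by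
        refine sum_le_card_nsmul _ _ _ fun C hC => ?_
        rw [mem_filter, hS, mem_filter] at hC
        have := h.linear_lower_bound_card_biUnion hC.1.2.2.1 hC.1.2.2.2 hL
        rw [hC.2] at this
        have e : 8 * L * k = 2 * (4 * L * k) := by ring
        exact pow_le_pow_of_le_one (by norm_num) (by norm_num) (by omega)
    _ ≤ (2 : ℝ) ^ (4 * L * k) * (1 / 2 : ℝ) ^ (4 * L * k + (d + d / 2)) := by
        rw [nsmul_eq_mul]
        gcongr
        exact_mod_cast hcard
    _ = (1 / 2 : ℝ) ^ (d + d / 2) := by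
        rw [pow_add, ← mul_assoc, ← mul_pow]; norm_num

open Classical in
lemma sum_large_linked_le (h : CubeLike N d) {L : ℕ} (hdL : d ≤ 2 ^ L) (hL : 0 < L)
    (hbig : 10 ^ 8 * (L : ℝ) ^ 3 ≤ √d) (v : V) :
    ∑ C with LinkedFrom (nbTwo N) v C ∧
        2 * (interiorOf N (C.biUnion N)).card ≤ Fintype.card V ∧ d ^ 2 ≤ 10 * (C.biUnion N).card,
      (1 / 2 : ℝ) ^ (C.biUnion N).card ≤ 2 * Real.exp (-(3 * d)) := by
  set S := univ.filter fun C : Finset V => LinkedFrom (nbTwo N) v C ∧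
    2 * (interiorOf N (C.biUnion N)).card ≤ Fintype.card V ∧
    d ^ 2 ≤ 10 * (C.biUnion N).card with hS
  set M := Fintype.card V with hM
  have hL1 : (1 : ℝ) ≤ L := by exact_mod_cast hL
  have hL3 : (L : ℝ) ≤ L ^ 3 := le_self_pow₀ hL1 (by norm_num)
  have hr1 : 1 ≤ √(d : ℝ) := by linarith
  have hrd : √(d : ℝ) ^ 2 = d := Real.sq_sqrt (by positivity)
  have hbigd : 10 ^ 8 * (L : ℝ) ≤ d := by nlinarith
  have hd128 : 128 * L ≤ d := by
    have : (128 : ℝ) * L ≤ d := by linarith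
    exact_mod_cast this
  have hd : 0 < d := by omega
  set ψ := d / (128 * L) with hψdef
  have hψ : 0 < ψ := Nat.div_pos hd128 (by positivity)
  have hψd : 128 * L * ψ ≤ d := Nat.mul_div_le _ _
  have hψd' : d ≤ 256 * L * ψ := by
    have h1 : d < 128 * L * (ψ + 1) := Nat.lt_mul_div_succ d (by positivity)
    have h2 : 128 * L * 1 ≤ 128 * L * ψ := Nat.mul_le_mul_left _ hψ
    have e1 : 128 * L * (ψ + 1) = 128 * L * ψ + 128 * L * 1 := by ring
    have e2 : 256 * L * ψ = 128 * L * ψ + 128 * L * ψ := by ring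
    omega
  have hexp : (d : ℝ) ≤ Real.exp L := by
    calc (d : ℝ) ≤ 2 ^ L := by exact_mod_cast hdL
      _ ≤ Real.exp 1 ^ L := by gcongr; linarith [Real.exp_one_gt_d9]
      _ = Real.exp L := by rw [← Real.exp_nat_mul, mul_one]
  have hmem : ∀ C ∈ S, ((C.biUnion N).card, (interiorOf N (C.biUnion N)).card) ∈
      range (M + 1) ×ˢ range (M + 1) := fun C _ => by
    rw [mem_product, mem_range, mem_range]
    exact ⟨Nat.lt_succ_of_le (card_le_univ _), Nat.lt_succ_of_le (card_le_univ _)⟩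
  rw [← sum_fiberwise_of_maps_to hmem]
  have hM1 : ((M + 1 : ℕ) : ℝ) ≤ Real.exp d := by
    have h1 : M + 1 ≤ 2 ^ d := by
      rw [hM, h.card_univ]
      have : 2 ^ d = 2 * 2 ^ (d - 1) := by rw [← pow_succ']; congr 1; omega
      have := Nat.one_le_two_pow (n := d - 1)
      omega
    calc ((M + 1 : ℕ) : ℝ) ≤ 2 ^ d := by exact_mod_cast h1
      _ ≤ Real.exp 1 ^ d := by gcongr; linarith [Real.exp_one_gt_d9]
      _ = Real.exp d := by rw [← Real.exp_nat_mul, mul_one]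
  refine (sum_le_card_nsmul _ _ (2 * Real.exp (-(5 * d))) fun p _ => ?_).trans ?_
  · obtain ⟨g, a⟩ := p
    rcases (S.filter fun C => ((C.biUnion N).card, (interiorOf N (C.biUnion N)).card) =
      (g, a)).eq_empty_or_nonempty with h0 | ⟨C₀, hC₀⟩
    · rw [h0, sum_empty]; positivity
    rw [mem_filter, hS, mem_filter, Prod.mk.injEq] at hC₀
    obtain ⟨⟨-, -, hhalf, hsq⟩, hg, ha⟩ := hC₀
    have hex := h.expand _ hhalf
    rw [biUnion_interiorOf_biUnion, ha, hg] at hex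
    rw [hg] at hsq
    have ht : (g : ℝ) ≤ 4 * √d * ((g : ℝ) - a) := by
      have : 0 ≤ (g : ℝ) - a := by
        by_contra! hneg
        have : (0 : ℝ) ≤ a := by positivity
        nlinarith
      nlinarith
    calc _ ≤ (S.filter fun C => ((C.biUnion N).card, (interiorOf N (C.biUnion N)).card) =
          (g, a)).card • (1 / 2 : ℝ) ^ g := by
          refine sum_le_card_nsmul _ _ _ fun C hC => ?_
          rw [mem_filter, Prod.mk.injEq] at hC
          rw [hC.2.1]
      _ ≤ 2 ^ g * (2 * Real.exp (20 * L * g / ψ + 8 * g / d ^ 3 -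
            ((g : ℝ) - a) / (128 * L))) * (1 / 2 : ℝ) ^ g := by
          rw [nsmul_eq_mul]
          gcongr
          refine le_trans ?_ (h.card_linkedFrom_le hd hL hexp hψ hψd v g a)
          refine Nat.cast_le.2 (card_le_card fun C hC => ?_)
          rw [mem_filter, hS, mem_filter, Prod.mk.injEq] at hC
          exact mem_filter.2 ⟨mem_univ _, hC.1.2.1, hC.2⟩
      _ = 2 * Real.exp (20 * L * g / ψ + 8 * g / d ^ 3 - ((g : ℝ) - a) / (128 * L)) := by
          rw [mul_right_comm, ← mul_pow]; norm_num
      _ ≤ 2 * Real.exp (-(5 * d)) := by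
          gcongr
          exact exponent_le_neg_five_mul hrd hL1 hbig (by exact_mod_cast hψ)
            (by exact_mod_cast hψd') (by exact_mod_cast hsq) ht
  · rw [card_product, card_range, nsmul_eq_mul, Nat.cast_mul]
    calc ((M + 1 : ℕ) : ℝ) * (M + 1 : ℕ) * (2 * Real.exp (-(5 * d)))
        ≤ Real.exp d * Real.exp d * (2 * Real.exp (-(5 * d))) := by gcongr
      _ = 2 * (Real.exp d * Real.exp d * Real.exp (-(5 * d))) := by ring
      _ = 2 * Real.exp (-(3 * d)) := by
          rw [← Real.exp_add, ← Real.exp_add]; ring_nf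

open Classical in
theorem sum_linked_le (h : CubeLike N d) {L : ℕ} (hdL : d ≤ 2 ^ L) (hL : 0 < L)
    (hbig : 10 ^ 8 * (L : ℝ) ^ 3 ≤ √d) (v : V) :
    ∑ C with LinkedFrom (nbTwo N) v C ∧
        2 * (interiorOf N (C.biUnion N)).card ≤ Fintype.card V,
      (1 / 2 : ℝ) ^ (C.biUnion N).card ≤
      (1 / 2 : ℝ) ^ d + d * (1 / 2 : ℝ) ^ (d + d / 2) + 2 * Real.exp (-(3 * d)) := by
  have hL1 : (1 : ℝ) ≤ L := by exact_mod_cast hL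
  have hL3 : (L : ℝ) ≤ L ^ 3 := le_self_pow₀ hL1 (by norm_num)
  have hrd : √(d : ℝ) ^ 2 = d := Real.sq_sqrt (by positivity)
  have hd16 : 16 * L ≤ d := by
    have : (16 : ℝ) * L ≤ d := by nlinarith
    exact_mod_cast this
  have hsmall := h.sum_small_linked_le hdL hd16 (by omega) v
  have hlarge := h.sum_large_linked_le hdL hL hbig v
  have hone : ∑ C ∈ {({v} : Finset V)}, (1 / 2 : ℝ) ^ (C.biUnion N).card = (1 / 2 : ℝ) ^ d := by
    rw [sum_singleton, singleton_biUnion, h.card_nbr]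
  refine le_trans ?_ (add_le_add (add_le_add hone.le hsmall) hlarge)
  have hpos : ∀ C : Finset V, 0 ≤ (1 / 2 : ℝ) ^ (C.biUnion N).card := fun _ => by positivity
  have hunion : ∀ S T : Finset (Finset V), ∑ C ∈ S ∪ T, (1 / 2 : ℝ) ^ (C.biUnion N).card ≤
      ∑ C ∈ S, (1 / 2 : ℝ) ^ (C.biUnion N).card + ∑ C ∈ T, (1 / 2 : ℝ) ^ (C.biUnion N).card := by
    intro S T
    rw [← sum_union_inter]
    exact le_add_of_nonneg_right (sum_nonneg fun C _ => hpos C)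
  refine (sum_le_sum_of_subset_of_nonneg (fun C hC => ?_) fun C _ _ => hpos C).trans
    ((hunion _ _).trans (add_le_add (hunion _ _) le_rfl))
  rw [mem_filter] at hC
  simp only [mem_union, mem_singleton, mem_filter, mem_univ, true_and]
  by_cases h1 : d ^ 2 ≤ 10 * (C.biUnion N).card
  · exact Or.inr ⟨hC.2.1, hC.2.2, h1⟩
  left
  by_cases h2 : 2 ≤ C.card
  · exact Or.inr ⟨hC.2.1, h2, not_le.1 h1⟩
  left
  have hv := hC.2.1.1
  exact (eq_singleton_iff_unique_mem.2 ⟨hv, fun x hx => card_le_one.1 (by omega) x hx v hv⟩)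

end CubeLike

end LinkedSum

section SeparatedPairs

open Finset

lemma cubeLike_ballOne (n : ℕ) : CubeLike (ballOne (n := n)) (n + 1) where
  symm := mem_ballOne_symm
  card_nbr x := card_ballOne x
  codegree x y hxy := card_ballOne_inter_le x y hxy
  card_univ := by simp
  expand A hA := card_le_two_mul_sqrt_mul_boundary A (by simpa using hA)

variable {V : Type*} [DecidableEq V] [Fintype V]

/-- Pairs of vertex sets without an edge between them. -/
def separatedPairs (N : V → Finset V) : Finset (Finset V × Finset V) :=
  univ.filter fun p => Disjoint (p.1.biUnion N) p.2

lemma mem_separatedPairs {N : V → Finset V} {p : Finset V × Finset V} :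
    p ∈ separatedPairs N ↔ Disjoint (p.1.biUnion N) p.2 := by simp [separatedPairs]

lemma swap_mem_separatedPairs {N : V → Finset V} (hN : ∀ x y, y ∈ N x → x ∈ N y)
    {p : Finset V × Finset V} (hp : p ∈ separatedPairs N) : p.swap ∈ separatedPairs N := by
  rw [mem_separatedPairs, disjoint_left] at *
  intro x hx hx'
  obtain ⟨y, hy, hxy⟩ := mem_biUnion.1 hx
  exact hp (mem_biUnion.2 ⟨x, hx', hN _ _ hxy⟩) hy

lemma card_filter_separatedPairs_snd {N : V → Finset V} (hN : ∀ x y, y ∈ N x → x ∈ N y)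
    (P : Finset V → Prop) [DecidablePred P] :
    ((separatedPairs N).filter fun p => P p.2).card =
      ((separatedPairs N).filter fun p => P p.1).card := by
  refine card_bij (fun p _ => p.swap) (fun p hp => ?_) (fun p _ q _ h => Prod.swap_injective h)
    fun p hp => ⟨p.swap, ?_, p.swap_swap⟩
  all_goals
    rw [mem_filter] at hp ⊢
    exact ⟨swap_mem_separatedPairs hN hp.1, hp.2⟩

lemma card_filter_separatedPairs_fst (N : V → Finset V) (P : Finset V → Prop)
    [DecidablePred P] :
    (((separatedPairs N).filter fun p => P p.1).card : ℝ) =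
      2 ^ Fintype.card V * ∑ A with P A, (1 / 2 : ℝ) ^ (A.biUnion N).card := by
  have hmap : ∀ p ∈ (separatedPairs N).filter fun p => P p.1, p.1 ∈ univ.filter P := fun p hp =>
    mem_filter.2 ⟨mem_univ _, (mem_filter.1 hp).2⟩
  rw [card_eq_sum_card_fiberwise hmap, Nat.cast_sum, mul_sum]
  refine sum_congr rfl fun A hA => ?_
  have : ((separatedPairs N).filter fun p => P p.1).filter (fun p => p.1 = A) =
      ((A.biUnion N)ᶜ.powerset).image fun B => (A, B) := by
    ext ⟨A', B⟩
    simp only [mem_filter, mem_separatedPairs, mem_image, mem_powerset, Prod.mk.injEq,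
      subset_compl_iff_disjoint_right]
    constructor
    · rintro ⟨⟨h1, _⟩, rfl⟩
      exact ⟨B, h1.symm, rfl, rfl⟩
    · rintro ⟨B', h1, rfl, rfl⟩
      exact ⟨⟨h1.symm, (mem_filter.1 hA).2⟩, rfl⟩
  rw [this, card_image_of_injective _ (Prod.mk_right_injective A), card_powerset, card_compl]
  have hle := card_le_univ (A.biUnion N)
  push_cast
  rw [one_div, inv_pow, eq_mul_inv_iff_mul_eq₀ (by positivity), ← pow_add,
    Nat.sub_add_cancel hle]

namespace CubeLike

variable {N : V → Finset V} {d : ℕ}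

lemma card_separatedPairs_le (h : CubeLike N d) (hd : 0 < d) {η : ℝ} (hη0 : 0 ≤ η)
    (hη : ∀ v, open Classical in ∑ C with LinkedFrom (nbTwo N) v C ∧
        2 * (interiorOf N (C.biUnion N)).card ≤ Fintype.card V,
      (1 / 2 : ℝ) ^ (C.biUnion N).card ≤ η) :
    ((separatedPairs N).card : ℝ) ≤
      2 * 2 ^ Fintype.card V * Real.exp (Fintype.card V * η) := by
  classical
  set P : Finset V → Prop := fun A => 2 * (interiorOf N (A.biUnion N)).card ≤ Fintype.card V
    with hP
  have hcover : separatedPairs N ⊆ ((separatedPairs N).filter fun p => P p.1) ∪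
      (separatedPairs N).filter fun p => P p.2 := by
    intro p hp
    rw [mem_union, mem_filter, mem_filter, ← and_or_left]
    refine ⟨hp, ?_⟩
    have h1 : Disjoint (interiorOf N (p.1.biUnion N)) (p.2.biUnion N) := by
      rw [disjoint_left]
      intro x hx hx'
      obtain ⟨b, hb, hxb⟩ := mem_biUnion.1 hx'
      exact disjoint_left.1 (mem_separatedPairs.1 hp) (mem_interiorOf.1 hx (h.symm _ _ hxb)) hb
    have h2 := card_le_univ (interiorOf N (p.1.biUnion N) ∪ p.2.biUnion N)
    rw [card_union_of_disjoint h1] at h2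
    have h3 := h.card_interiorOf_le hd p.2
    simp only [hP]
    omega
  have hmono : ∀ A B : Finset V, A ⊆ B → P B → P A := by
    intro A B hAB hB
    refine le_trans (Nat.mul_le_mul_left _ (card_le_card fun x hx => ?_)) hB
    exact mem_interiorOf.2
      ((mem_interiorOf.1 hx).trans (biUnion_subset_biUnion_of_subset_left _ hAB))
  have hsum : ∑ A with P A, (1 / 2 : ℝ) ^ (A.biUnion N).card ≤
      Real.exp (Fintype.card V * η) := by
    refine le_trans (b := (1 + η) ^ Fintype.card V) ?_ ?_
    · refine (le_of_eq ?_).trans (sum_weight_le_one_add_pow h.symm hmono hη0 fun v =>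
        (le_of_eq ?_).trans (hη v)) <;> congr!
    · rw [Real.exp_nat_mul]
      gcongr
      rw [add_comm]
      exact Real.add_one_le_exp _
  have h1 : (separatedPairs N).card ≤ ((separatedPairs N).filter fun p => P p.1).card +
      ((separatedPairs N).filter fun p => P p.1).card := by
    refine (card_le_card hcover).trans ((card_union_le _ _).trans ?_)
    rw [card_filter_separatedPairs_snd h.symm P]
  have h2 : ((separatedPairs N).card : ℝ) ≤ ((separatedPairs N).filter fun p => P p.1).card +
      ((separatedPairs N).filter fun p => P p.1).card := by exact_mod_cast h1
  rw [card_filter_separatedPairs_fst N P] at h2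
  have h3 : (2 : ℝ) ^ Fintype.card V * ∑ A with P A, (1 / 2 : ℝ) ^ (A.biUnion N).card ≤
    2 ^ Fintype.card V * Real.exp (Fintype.card V * η) := by gcongr
  linarith

lemma sum_pow_card_ge (h : CubeLike N d) (hd : 0 < d) :
    Real.exp (1 / 2) - 4 * (1 / 2 : ℝ) ^ d ≤
      ∑ A : Finset V with A.card ≤ d, (1 / 2 : ℝ) ^ (A.biUnion N).card := by
  set x : ℝ := (1 / 2) ^ d with hx
  set M := Fintype.card V with hM
  have hx0 : 0 < x := by positivity
  have hx1 : x ≤ 1 / 2 := by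
    rw [hx]
    exact pow_le_of_le_one (by norm_num) (by norm_num) hd.ne'
  have hMx : (M : ℝ) * x = 1 / 2 := by
    rw [hM, h.card_univ, hx]
    obtain ⟨k, rfl⟩ : ∃ k, d = k + 1 := ⟨d - 1, by omega⟩
    rw [Nat.add_sub_cancel, pow_succ]
    push_cast
    rw [← mul_assoc, ← mul_pow]
    norm_num
  have hsum : ∀ y : ℝ, ∑ A : Finset V, y ^ A.card = (y + 1) ^ M := by
    intro y
    have := Fintype.sum_pow_mul_eq_add_pow V y 1
    simpa using this
  have h1 : ∑ A : Finset V with A.card ≤ d, x ^ A.card ≤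
      ∑ A : Finset V with A.card ≤ d, (1 / 2 : ℝ) ^ (A.biUnion N).card := by
    refine sum_le_sum fun A _ => ?_
    rw [hx, ← pow_mul, mul_comm]
    exact pow_le_pow_of_le_one (by norm_num) (by norm_num) (h.card_biUnion_le A)
  have h2 : ∑ A : Finset V with ¬ A.card ≤ d, x ^ A.card ≤ 3 * x := by
    calc ∑ A : Finset V with ¬ A.card ≤ d, x ^ A.card
        ≤ ∑ A : Finset V with ¬ A.card ≤ d, x * (2 * x) ^ A.card := by
          refine sum_le_sum fun A hA => ?_
          have : (1 : ℝ) ≤ x * 2 ^ A.card := by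
            calc (1 : ℝ) = x * 2 ^ d := by rw [hx, ← mul_pow]; norm_num
              _ ≤ x * 2 ^ A.card := by
                gcongr
                · norm_num
                · exact (not_le.1 (mem_filter.1 hA).2).le
          rw [mul_pow, ← mul_assoc]
          exact le_mul_of_one_le_left (by positivity) this
      _ ≤ ∑ A : Finset V, x * (2 * x) ^ A.card :=
          sum_le_sum_of_subset_of_nonneg (filter_subset _ _) fun _ _ _ => by positivity
      _ = x * (2 * x + 1) ^ M := by rw [← mul_sum, hsum]
      _ ≤ x * Real.exp (2 * x) ^ M := by
          gcongr
          exact Real.add_one_le_exp _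
      _ = x * Real.exp 1 := by
          rw [← Real.exp_nat_mul, mul_left_comm, hMx]; norm_num
      _ ≤ 3 * x := by
          have := Real.exp_one_lt_d9
          nlinarith
  have h3 : Real.exp (1 / 2) - x ≤ (x + 1) ^ M := by
    have e1 : Real.exp (x - x ^ 2) ≤ x + 1 := by
      rw [← Real.le_log_iff_exp_le (by linarith)]
      have := Real.one_sub_inv_le_log_of_pos (show 0 < x + 1 by linarith)
      refine le_trans ?_ this
      rw [le_sub_iff_add_le, ← le_sub_iff_add_le', inv_eq_one_div, div_le_iff₀ (by linarith)]
      nlinarith [pow_pos hx0 3]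
    have e2 : Real.exp (1 / 2 - x / 2) ≤ (x + 1) ^ M := by
      calc Real.exp (1 / 2 - x / 2) = Real.exp (x - x ^ 2) ^ M := by
            rw [← Real.exp_nat_mul]
            congr 1
            linear_combination (x - 1) * hMx
        _ ≤ (x + 1) ^ M := by gcongr
    refine le_trans ?_ e2
    rw [sub_eq_add_neg (1 / 2 : ℝ), Real.exp_add]
    have e3 := Real.add_one_le_exp (-(x / 2))
    have e4 : Real.exp (1 / 2) ≤ 2 := by
      rw [← Real.le_log_iff_exp_le (by norm_num)]
      linarith [Real.log_two_gt_d9]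
    have e5 := Real.exp_pos (1 / 2)
    nlinarith
  have h4 := sum_filter_add_sum_filter_not (univ : Finset (Finset V)) (fun A => A.card ≤ d)
    fun A => x ^ A.card
  rw [hsum] at h4
  linarith

lemma le_card_separatedPairs (h : CubeLike N d) (hd : 0 < d) :
    2 * 2 ^ Fintype.card V * (Real.exp (1 / 2) - 4 * (1 / 2 : ℝ) ^ d) -
      Real.exp (2 * d ^ 2 + 2) ≤ (separatedPairs N).card := by
  set S := separatedPairs N
  set S₁ := S.filter fun p => p.1.card ≤ d with hS₁
  set S₂ := S.filter fun p => p.2.card ≤ d with hS₂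
  set T := (univ : Finset (Finset V)).filter fun A => A.card ≤ d with hT
  have h1 : S₁.card + S₂.card ≤ S.card + T.card * T.card := by
    rw [← card_union_add_card_inter, ← card_product]
    refine add_le_add (card_le_card (union_subset (filter_subset _ _) (filter_subset _ _)))
      (card_le_card fun p hp => ?_)
    rw [mem_inter, hS₁, hS₂, mem_filter, mem_filter] at hp
    exact mem_product.2 ⟨mem_filter.2 ⟨mem_univ _, hp.1.2⟩, mem_filter.2 ⟨mem_univ _, hp.2.2⟩⟩
  have h2 : S₂.card = S₁.card := card_filter_separatedPairs_snd h.symm (fun A => A.card ≤ d)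
  have h3 : 2 ^ Fintype.card V * (Real.exp (1 / 2) - 4 * (1 / 2 : ℝ) ^ d) ≤ S₁.card := by
    rw [hS₁, card_filter_separatedPairs_fst N (fun A => A.card ≤ d)]
    gcongr
    exact h.sum_pow_card_ge hd
  have h4 : (T.card : ℝ) ≤ Real.exp (d ^ 2 + 1) := by
    have e1 := card_filter_powerset_le_exp (univ : Finset V) (q := d) (by positivity) d
    have e2 : T = (univ : Finset V).powerset.filter fun X => (X.card : ℝ) ≤ d := by
      rw [hT, powerset_univ]; simp
    rw [← e2] at e1
    refine e1.trans (Real.exp_le_exp.2 ?_)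
    have e3 : (Fintype.card V : ℝ) ≤ Real.exp d := by
      rw [h.card_univ]
      calc ((2 ^ (d - 1) : ℕ) : ℝ) ≤ 2 ^ d := by
            exact_mod_cast Nat.pow_le_pow_right (by norm_num) (Nat.sub_le d 1)
        _ ≤ Real.exp 1 ^ d := by gcongr; linarith [Real.exp_one_gt_d9]
        _ = Real.exp d := by rw [← Real.exp_nat_mul, mul_one]
    have e4 : (Fintype.card V : ℝ) * Real.exp (-d) ≤ 1 := by
      calc (Fintype.card V : ℝ) * Real.exp (-d) ≤ Real.exp d * Real.exp (-d) := by gcongr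
        _ = 1 := by rw [← Real.exp_add, add_neg_cancel, Real.exp_zero]
    rw [Finset.card_univ]
    nlinarith
  have h5 : (T.card : ℝ) * T.card ≤ Real.exp (2 * d ^ 2 + 2) := by
    calc (T.card : ℝ) * T.card ≤ Real.exp (d ^ 2 + 1) * Real.exp (d ^ 2 + 1) := by gcongr
      _ = _ := by rw [← Real.exp_add]; ring_nf
  have h6 : (S₁.card : ℝ) + S₂.card ≤ S.card + T.card * T.card := by exact_mod_cast h1
  rw [h2] at h6
  linarith

end CubeLike

end SeparatedPairs

section Asymptotics

open Finset Filter

lemma eventually_mul_pow_le_two_pow (k : ℕ) (K : ℝ) :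
    ∀ᶠ n : ℕ in atTop, K * (n : ℝ) ^ k ≤ 2 ^ n := by
  have h := (tendsto_pow_const_mul_const_pow_of_abs_lt_one k
    (show |(1 / 2 : ℝ)| < 1 by rw [abs_of_pos] <;> norm_num)).const_mul K
  rw [mul_zero] at h
  filter_upwards [h.eventually_le_const one_pos] with n hn
  rwa [one_div, inv_pow, ← mul_assoc, ← div_eq_mul_inv, div_le_one (by positivity)] at hn

lemma eventually_exists_log_bound :
    ∀ᶠ d : ℕ in atTop, ∃ L : ℕ, 0 < L ∧ d ≤ 2 ^ L ∧ 10 ^ 8 * (L : ℝ) ^ 3 ≤ √d := by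
  obtain ⟨L₀, hL₀⟩ := eventually_atTop.1 (eventually_mul_pow_le_two_pow 6 (2 * 10 ^ 16))
  filter_upwards [eventually_ge_atTop (2 ^ L₀)] with d hd
  have hd0 : d ≠ 0 := (lt_of_lt_of_le (by positivity) hd).ne'
  refine ⟨Nat.log 2 d + 1, by omega, (Nat.lt_pow_succ_log_self (by norm_num) d).le, ?_⟩
  have h1 := hL₀ (Nat.log 2 d + 1) (Nat.le_succ_of_le (Nat.le_log_of_pow_le (by norm_num) hd))
  have h2 : (2 : ℝ) ^ Nat.log 2 d ≤ d := by exact_mod_cast Nat.pow_log_le_self 2 hd0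
  refine Real.le_sqrt_of_sq_le ?_
  rw [pow_succ 2 (Nat.log 2 d)] at h1
  rw [mul_pow, ← pow_mul, ← pow_mul]
  norm_num at h1 ⊢
  linarith

lemma eventually_mul_exp_neg_le :
    ∀ᶠ d : ℕ in atTop, (d : ℝ) * Real.exp (-(d / 3)) ≤ Real.exp (-(d / 12)) / 100 := by
  have h1 := (Real.tendsto_pow_mul_exp_neg_atTop_nhds_zero 1).comp
    ((tendsto_natCast_atTop_atTop (R := ℝ)).atTop_div_const (show (0 : ℝ) < 4 by norm_num))
  filter_upwards [h1.eventually_le_const (show (0 : ℝ) < 1 / 400 by norm_num)] with d hd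
  have e : Real.exp (-((d : ℝ) / 3)) = Real.exp (-(d / 4)) * Real.exp (-(d / 12)) := by
    rw [← Real.exp_add]; ring_nf
  simp only [Function.comp_apply, pow_one] at hd
  rw [e]
  have := mul_le_mul_of_nonneg_right hd (Real.exp_pos (-((d : ℝ) / 12))).le
  linarith

lemma eventually_exp_sq_le :
    ∀ᶠ d : ℕ in atTop, Real.exp (2 * d ^ 2 + 2) ≤
      Real.exp (-(d / 12)) / 100 * 2 ^ 2 ^ (d - 1) := by
  filter_upwards [eventually_mul_pow_le_two_pow 3 8, eventually_ge_atTop 10] with d hd hd10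
  have hd10' : (10 : ℝ) ≤ d := by exact_mod_cast hd10
  have h1 : 4 * (d : ℝ) ^ 3 ≤ 2 ^ (d - 1) := by
    obtain ⟨k, rfl⟩ : ∃ k, d = k + 1 := ⟨d - 1, by omega⟩
    rw [pow_succ 2] at hd
    rw [Nat.add_sub_cancel]
    linarith
  have h2 : (100 : ℝ) ≤ Real.exp 5 := by
    have : Real.exp 5 = Real.exp 1 ^ 5 := by rw [← Real.exp_nat_mul]; norm_num
    rw [this]
    calc (100 : ℝ) ≤ 2.7 ^ 5 := by norm_num
      _ ≤ Real.exp 1 ^ 5 := by gcongr; linarith [Real.exp_one_gt_d9]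
  have h3 : Real.exp (2 ^ (d - 1) * (1 / 2)) ≤ 2 ^ 2 ^ (d - 1) := by
    have e : Real.exp (1 / 2) ≤ 2 := by
      rw [← Real.le_log_iff_exp_le (by norm_num)]
      linarith [Real.log_two_gt_d9]
    calc Real.exp (2 ^ (d - 1) * (1 / 2)) = Real.exp (1 / 2) ^ 2 ^ (d - 1) := by
          rw [← Real.exp_nat_mul]; push_cast; rfl
      _ ≤ 2 ^ 2 ^ (d - 1) := by gcongr
  rw [div_mul_eq_mul_div, le_div_iff₀ (by norm_num)]
  calc Real.exp (2 * d ^ 2 + 2) * 100 ≤ Real.exp (2 * d ^ 2 + 2) * Real.exp 5 := by gcongr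
    _ ≤ Real.exp (-(d / 12)) * Real.exp (2 ^ (d - 1) * (1 / 2)) := by
        rw [← Real.exp_add, ← Real.exp_add]
        refine Real.exp_le_exp.2 ?_
        have : 10 * (d : ℝ) ^ 2 ≤ d ^ 3 := by nlinarith [sq_nonneg (d : ℝ)]
        nlinarith
    _ ≤ _ := by gcongr

theorem eventually_card_separatedPairs :
    ∀ᶠ d : ℕ in atTop, |((separatedPairs (ballOne (n := d - 1))).card : ℝ) -
      2 * Real.exp (1 / 2) * 2 ^ 2 ^ (d - 1)| ≤
        24 * (Real.exp (-(d / 12)) / 100 * 2 ^ 2 ^ (d - 1)) := by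
  filter_upwards [eventually_exists_log_bound, eventually_mul_exp_neg_le, eventually_exp_sq_le,
    eventually_ge_atTop 1] with d hL hB hC hd
  obtain ⟨L, hL0, hdL, hbig⟩ := hL
  have h : CubeLike (ballOne (n := d - 1)) d := by
    have := cubeLike_ballOne (d - 1)
    rwa [Nat.sub_add_cancel hd] at this
  set ε := Real.exp (-((d : ℝ) / 12)) / 100 with hε
  have hd1 : (1 : ℝ) ≤ d := by exact_mod_cast hd
  have hcard : Fintype.card (Fin (d - 1) → Bool) = 2 ^ (d - 1) := h.card_univ
  have hupper := h.card_separatedPairs_le hd (by positivity) (h.sum_linked_le hdL hL0 hbig)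
  have hlower := h.le_card_separatedPairs hd
  rw [hcard] at hupper hlower
  set T : ℝ := 2 ^ 2 ^ (d - 1) with hT
  have hT0 : 0 < T := by positivity
  have hlog := Real.log_two_gt_d9
  have hhalf : ∀ k : ℕ, (1 / 2 : ℝ) ^ k = Real.exp (-(k * Real.log 2)) := by
    intro k
    rw [Real.exp_neg, Real.exp_nat_mul, Real.exp_log (by norm_num), one_div, inv_pow]
  have hpow1 : (1 / 2 : ℝ) ^ d ≤ ε := by
    rw [hhalf]
    calc Real.exp (-(d * Real.log 2)) ≤ Real.exp (-(d / 3)) := by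
          refine Real.exp_le_exp.2 ?_
          nlinarith
      _ ≤ d * Real.exp (-(d / 3)) := le_mul_of_one_le_left (Real.exp_pos _).le hd1
      _ ≤ ε := hB
  have hpow2 : (1 / 2 : ℝ) ^ (d / 2) ≤ 2 * Real.exp (-(d / 3)) := by
    rw [hhalf]
    calc Real.exp (-((d / 2 : ℕ) * Real.log 2)) ≤ Real.exp (Real.log 2 + -(d / 3)) := by
          refine Real.exp_le_exp.2 ?_
          have h1 : (d : ℝ) ≤ 2 * (d / 2 : ℕ) + 1 := by
            exact_mod_cast (show d ≤ 2 * (d / 2) + 1 by omega)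
          nlinarith
      _ = 2 * Real.exp (-(d / 3)) := by rw [Real.exp_add, Real.exp_log (by norm_num)]
  have hM : ((2 ^ (d - 1) : ℕ) : ℝ) * (1 / 2) ^ d = 1 / 2 := by
    obtain ⟨k, rfl⟩ : ∃ k, d = k + 1 := ⟨d - 1, by omega⟩
    rw [Nat.add_sub_cancel, pow_succ (1 / 2 : ℝ)]
    push_cast
    rw [← mul_assoc, ← mul_pow]
    norm_num
  have hMexp : ((2 ^ (d - 1) : ℕ) : ℝ) ≤ Real.exp d := by
    calc ((2 ^ (d - 1) : ℕ) : ℝ) ≤ 2 ^ d := by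
          exact_mod_cast Nat.pow_le_pow_right (by norm_num) (Nat.sub_le d 1)
      _ ≤ Real.exp 1 ^ d := by gcongr; linarith [Real.exp_one_gt_d9]
      _ = Real.exp d := by rw [← Real.exp_nat_mul, mul_one]
  have hexp : ((2 ^ (d - 1) : ℕ) : ℝ) *
      ((1 / 2) ^ d + d * (1 / 2) ^ (d + d / 2) + 2 * Real.exp (-(3 * d))) ≤ 1 / 2 + 3 * ε := by
    have e1 : ((2 ^ (d - 1) : ℕ) : ℝ) * (d * (1 / 2) ^ (d + d / 2)) ≤ ε := by
      calc ((2 ^ (d - 1) : ℕ) : ℝ) * (d * (1 / 2) ^ (d + d / 2))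
          = ((2 ^ (d - 1) : ℕ) * (1 / 2) ^ d) * (d * (1 / 2) ^ (d / 2)) := by
            rw [pow_add]; ring
        _ = 1 / 2 * (d * (1 / 2) ^ (d / 2)) := by rw [hM]
        _ ≤ 1 / 2 * (d * (2 * Real.exp (-(d / 3)))) := by gcongr
        _ = d * Real.exp (-(d / 3)) := by ring
        _ ≤ ε := hB
    have e2 : ((2 ^ (d - 1) : ℕ) : ℝ) * (2 * Real.exp (-(3 * d))) ≤ 2 * ε := by
      calc ((2 ^ (d - 1) : ℕ) : ℝ) * (2 * Real.exp (-(3 * d)))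
          ≤ Real.exp d * (2 * Real.exp (-(3 * d))) := by gcongr
        _ = 2 * Real.exp (-(2 * d)) := by rw [mul_left_comm, ← Real.exp_add]; ring_nf
        _ ≤ 2 * (d * Real.exp (-(d / 3))) := by
            gcongr
            refine le_trans (Real.exp_le_exp.2 ?_)
              (le_mul_of_one_le_left (Real.exp_pos _).le hd1)
            linarith
        _ ≤ 2 * ε := by gcongr
    rw [mul_add, mul_add, hM]
    linarith
  have hε0 : 0 < ε := by positivity
  have hε1 : ε ≤ 1 / 100 := by
    have : Real.exp (-((d : ℝ) / 12)) ≤ 1 := Real.exp_le_one_iff.2 (by linarith)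
    rw [hε]; linarith
  have hroot : Real.exp (1 / 2) ≤ 2 := by
    rw [← Real.le_log_iff_exp_le (by norm_num)]
    linarith
  have hexp' : Real.exp (1 / 2 + 3 * ε) ≤ Real.exp (1 / 2) + 12 * ε := by
    have e1 : Real.exp (3 * ε) ≤ 1 + 6 * ε := by
      have e2 := Real.add_one_le_exp (-(3 * ε))
      have e3 : Real.exp (3 * ε) * Real.exp (-(3 * ε)) = 1 := by
        rw [← Real.exp_add, add_neg_cancel, Real.exp_zero]
      have e4 := mul_le_mul_of_nonneg_left e2 (Real.exp_pos (3 * ε)).le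
      have e5 := Real.exp_pos (3 * ε)
      nlinarith
    rw [Real.exp_add]
    have := Real.exp_pos (1 / 2)
    nlinarith
  rw [abs_le]
  constructor
  · have := mul_le_mul_of_nonneg_left hpow1 hT0.le
    nlinarith
  · have h1 := hupper.trans (mul_le_mul_of_nonneg_left
      ((Real.exp_le_exp.2 hexp).trans hexp') (by positivity))
    nlinarith

end Asymptotics

section Parity

open Finset

/-- The number of coordinates in which `u` and `v` differ. -/
def diffCount {n : ℕ} (u v : Fin n → Bool) : ℕ := (univ.filter fun i => u i ≠ v i).card

/-- The sum of the coordinates of `u`, modulo two. -/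
def coordParity {n : ℕ} (u : Fin n → Bool) : ZMod 2 := ∑ i, if u i then 1 else 0

lemma coordParity_sub {n : ℕ} (u v : Fin n → Bool) :
    coordParity u - coordParity v = (diffCount u v : ZMod 2) := by
  rw [coordParity, coordParity, ← sum_sub_distrib, diffCount, natCast_card_filter]
  refine sum_congr rfl fun i _ => ?_
  cases u i <;> cases v i <;> decide

lemma diffCount_eq_zero {n : ℕ} {u v : Fin n → Bool} (h : diffCount u v = 0) : u = v := by
  rw [diffCount, card_eq_zero, filter_eq_empty_iff] at h
  exact funext fun i => not_not.1 (h (mem_univ i))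

lemma diffCount_succ {n : ℕ} (u v : Fin (n + 1) → Bool) :
    diffCount u v = (if u 0 ≠ v 0 then 1 else 0) + diffCount (Fin.tail u) (Fin.tail v) := by
  rw [diffCount, card_filter, Fin.sum_univ_succ, ← card_filter]
  rfl

lemma mem_ballOne_iff_diffCount_le {n : ℕ} {x y : Fin n → Bool} :
    y ∈ ballOne x ↔ diffCount x y ≤ 1 := by
  rw [mem_ballOne]
  constructor
  · rintro (rfl | ⟨i, rfl⟩)
    · simp [diffCount]
    · refine (card_le_card (t := {i}) fun j hj => ?_).trans_eq (card_singleton i)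
      by_contra hji
      rw [mem_singleton] at hji
      exact (mem_filter.1 hj).2 (flipAt_apply_of_ne _ hji).symm
  · intro h
    rcases Nat.le_one_iff_eq_zero_or_eq_one.1 h with h | h
    · exact Or.inl (diffCount_eq_zero h).symm
    · obtain ⟨i, hi⟩ := card_eq_one.1 h
      refine Or.inr ⟨i, funext fun j => ?_⟩
      have hj : x j ≠ y j ↔ j = i := by
        have := congrArg (j ∈ ·) hi
        simpa using this
      by_cases hji : j = i
      · subst hji
        rw [flipAt_apply_self]
        have := hj.2 rfl
        cases h1 : x j <;> cases h2 : y j <;> simp_all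
      · rw [flipAt_apply_of_ne _ hji]
        exact not_not.1 (mt hj.1 hji)

lemma cubeAdj_iff {n : ℕ} {u v : Fin (n + 1) → Bool} :
    cubeAdj (n + 1) u v ↔ coordParity u ≠ coordParity v ∧ Fin.tail v ∈ ballOne (Fin.tail u) := by
  rw [mem_ballOne_iff_diffCount_le, ← sub_ne_zero, coordParity_sub, Ne,
    ZMod.natCast_eq_zero_iff]
  change diffCount u v = 1 ↔ _
  have := diffCount_succ u v
  split_ifs at this <;> omega

/-- The vertex with the given parity and the given last coordinates. -/
def liftParity {n : ℕ} (σ : ZMod 2) (y : Fin n → Bool) : Fin (n + 1) → Bool :=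
  Fin.cons (decide (σ ≠ coordParity y)) y

lemma tail_liftParity {n : ℕ} (σ : ZMod 2) (y : Fin n → Bool) :
    Fin.tail (liftParity σ y) = y := Fin.tail_cons _ _

lemma coordParity_liftParity {n : ℕ} (σ : ZMod 2) (y : Fin n → Bool) :
    coordParity (liftParity σ y) = σ := by
  have h : coordParity (liftParity σ y) =
      (if decide (σ ≠ coordParity y) then 1 else 0) + coordParity y := by
    rw [coordParity, Fin.sum_univ_succ]
    simp only [liftParity, Fin.cons_zero, Fin.cons_succ]
    rfl
  rw [h]
  clear h
  generalize coordParity y = τ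
  revert σ τ
  decide

lemma eq_of_coordParity_eq {n : ℕ} {u v : Fin (n + 1) → Bool}
    (h : coordParity u = coordParity v) (ht : Fin.tail u = Fin.tail v) : u = v := by
  refine diffCount_eq_zero ?_
  have h1 := diffCount_succ u v
  have h2 : diffCount (Fin.tail u) (Fin.tail v) = 0 := by simp [ht, diffCount]
  have h3 := coordParity_sub u v
  rw [h, sub_self, eq_comm, ZMod.natCast_eq_zero_iff] at h3
  split_ifs at h1 <;> omega

lemma liftParity_coordParity {n : ℕ} (u : Fin (n + 1) → Bool) :
    liftParity (coordParity u) (Fin.tail u) = u :=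
  eq_of_coordParity_eq (coordParity_liftParity _ _) (tail_liftParity _ _)

lemma reflTransGen_cubeAdj {d : ℕ} (u v : Fin d → Bool) :
    Relation.ReflTransGen (cubeAdj d) u v := by
  have h : ∀ s : Finset (Fin d),
      Relation.ReflTransGen (cubeAdj d) u fun i => if i ∈ s then v i else u i := by
    intro s
    induction s using Finset.induction_on with
    | empty => simpa using Relation.ReflTransGen.refl
    | insert i s hi ih =>
      by_cases huv : u i = v i
      · convert ih using 2 with j
        by_cases hj : j = i <;> simp_all
      · refine ih.tail (card_eq_one.2 ⟨i, ?_⟩)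
        ext j
        by_cases hj : j = i <;> simp_all
  simpa using h univ

lemma intCast_sub_eq_coordParity_sub {d : ℕ} {f : (Fin d → Bool) → ℤ} (hf : f ∈ HomF d)
    (u v : Fin d → Bool) : ((f u - f v : ℤ) : ZMod 2) = coordParity u - coordParity v := by
  induction reflTransGen_cubeAdj u v with
  | refl => simp
  | @tail w z _ hwz ih =>
    have h1 : ((f w - f z : ℤ) : ZMod 2) = 1 := by
      rcases (abs_eq zero_le_one).1 (hf.2 w z hwz) with h | h <;> rw [h] <;> decide
    have h2 : coordParity w - coordParity z = 1 := by
      rw [coordParity_sub]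
      have : diffCount w z = 1 := hwz
      rw [this, Nat.cast_one]
    rw [← sub_add_sub_cancel (f u) (f w) (f z), Int.cast_add, ih, h1, ← h2, sub_add_sub_cancel]

lemma exists_eq_of_mem_Icc {d : ℕ} {f : (Fin d → Bool) → ℤ} (hf : f ∈ HomF d)
    (u v : Fin d → Bool) (k : ℤ) (hu : f u ≤ k) (hv : k ≤ f v) : ∃ w, f w = k := by
  induction reflTransGen_cubeAdj u v with
  | refl => exact ⟨u, by omega⟩
  | @tail w z _ hwz ih =>
    by_cases hw : k ≤ f w
    · exact ih hw
    · have := abs_le.1 (hf.2 w z hwz).le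
      exact ⟨z, by omega⟩

end Parity

section Reduction

open Finset

/-- The function with values in `{0, 1, 2, 3}` that is `0` exactly on the vertices of parity `σ`
over `A` and `3` exactly on the vertices of the other parity over `B`. -/
def heightFn {n : ℕ} (σ : ZMod 2) (A B : Finset (Fin n → Bool)) (u : Fin (n + 1) → Bool) : ℤ :=
  if coordParity u = σ then (if Fin.tail u ∈ A then 0 else 2)
  else if Fin.tail u ∈ B then 3 else 1

variable {n : ℕ} {σ : ZMod 2} {A B : Finset (Fin n → Bool)}

lemma heightFn_nonneg (u : Fin (n + 1) → Bool) : 0 ≤ heightFn σ A B u := by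
  unfold heightFn; split_ifs <;> norm_num

lemma heightFn_le (u : Fin (n + 1) → Bool) : heightFn σ A B u ≤ 3 := by
  unfold heightFn; split_ifs <;> norm_num

lemma heightFn_eq_zero {u : Fin (n + 1) → Bool} :
    heightFn σ A B u = 0 ↔ coordParity u = σ ∧ Fin.tail u ∈ A := by
  unfold heightFn; split_ifs <;> simp_all

lemma heightFn_eq_three {u : Fin (n + 1) → Bool} :
    heightFn σ A B u = 3 ↔ coordParity u ≠ σ ∧ Fin.tail u ∈ B := by
  unfold heightFn; split_ifs <;> simp_all

lemma abs_heightFn_sub (h : (A, B) ∈ separatedPairs (ballOne (n := n)))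
    {u v : Fin (n + 1) → Bool} (huv : cubeAdj (n + 1) u v) :
    |heightFn σ A B u - heightFn σ A B v| = 1 := by
  rw [cubeAdj_iff] at huv
  have hσ : coordParity u = σ ↔ ¬ coordParity v = σ := by
    have := huv.1
    revert this
    generalize coordParity u = a
    generalize coordParity v = b
    revert a b σ
    decide
  have hsep : ∀ x y, y ∈ ballOne x → x ∈ A → y ∉ B := fun x y hxy hx hy =>
    disjoint_left.1 (mem_separatedPairs.1 h) (mem_biUnion.2 ⟨x, hx, hxy⟩) hy
  have h1 := hsep _ _ huv.2
  have h2 := hsep _ _ (mem_ballOne_symm _ _ huv.2)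
  unfold heightFn
  split_ifs <;> simp_all

lemma mem_HomF_heightFn (h : (A, B) ∈ separatedPairs (ballOne (n := n))) :
    (fun u => heightFn σ A B u - heightFn σ A B fun _ => false) ∈ HomF (n + 1) :=
  ⟨sub_self _, fun u v huv => by
    rw [sub_sub_sub_cancel_right]; exact abs_heightFn_sub h huv⟩

lemma exists_heightFn_eq_zero (hA : A.Nonempty) : ∃ u, heightFn σ A B u = 0 := by
  obtain ⟨x, hx⟩ := hA
  exact ⟨liftParity σ x, heightFn_eq_zero.2 ⟨coordParity_liftParity _ _,
    by rwa [tail_liftParity]⟩⟩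

lemma exists_heightFn_eq_three (hB : B.Nonempty) : ∃ u, heightFn σ A B u = 3 := by
  obtain ⟨x, hx⟩ := hB
  refine ⟨liftParity (σ + 1) x, heightFn_eq_three.2 ⟨?_, by rwa [tail_liftParity]⟩⟩
  rw [coordParity_liftParity]
  simp

lemma mem_HomFi_heightFn (h : (A, B) ∈ separatedPairs (ballOne (n := n))) (hA : A.Nonempty)
    (hB : B.Nonempty) :
    (fun u => heightFn σ A B u - heightFn σ A B fun _ => false) ∈ HomFi (n + 1) 4 := by
  set c := heightFn σ A B fun _ => false
  refine ⟨mem_HomF_heightFn h, ?_⟩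
  have : Set.range (fun u => heightFn σ A B u - c) = (Finset.Icc (0 - c) (3 - c) : Set ℤ) := by
    ext k
    simp only [Set.mem_range, coe_Icc, Set.mem_Icc]
    constructor
    · rintro ⟨u, rfl⟩
      exact ⟨sub_le_sub_right (heightFn_nonneg u) _, sub_le_sub_right (heightFn_le u) _⟩
    · rintro ⟨h0, h3⟩
      obtain ⟨u, hu⟩ := exists_heightFn_eq_zero (σ := σ) (B := B) hA
      obtain ⟨v, hv⟩ := exists_heightFn_eq_three (σ := σ) (A := A) hB
      exact exists_eq_of_mem_Icc (mem_HomF_heightFn (σ := σ) h) u v k (by rwa [hu]) (by rwa [hv])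
  rw [this, Set.ncard_coe_finset, Int.card_Icc]
  omega

lemma heightFn_injective {τ : ZMod 2} {A' B' : Finset (Fin n → Bool)} (hA : A.Nonempty)
    (hA' : A'.Nonempty)
    (h : (fun u => heightFn σ A B u - heightFn σ A B fun _ => false) =
      fun u => heightFn τ A' B' u - heightFn τ A' B' fun _ => false) :
    σ = τ ∧ A = A' ∧ B = B' := by
  have h0 : ∀ u, heightFn σ A B u = heightFn τ A' B' u := by
    intro u
    obtain ⟨w, hw⟩ := exists_heightFn_eq_zero (σ := σ) (B := B) hA
    obtain ⟨w', hw'⟩ := exists_heightFn_eq_zero (σ := τ) (B := B') hA'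
    have e1 := congrFun h u
    have e2 := congrFun h w
    have e3 := congrFun h w'
    have e4 := heightFn_nonneg (σ := τ) (A := A') (B := B') w
    have e5 := heightFn_nonneg (σ := σ) (A := A) (B := B) w'
    simp only at e1 e2 e3
    omega
  obtain ⟨w, hw⟩ := exists_heightFn_eq_zero (σ := σ) (B := B) hA
  have hστ : σ = τ := by
    have hw' := hw
    rw [h0] at hw'
    rw [← (heightFn_eq_zero.1 hw).1, (heightFn_eq_zero.1 hw').1]
  subst hστ
  refine ⟨rfl, ?_, ?_⟩
  · ext x
    have := h0 (liftParity σ x)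
    simp only [heightFn, coordParity_liftParity, tail_liftParity, if_true] at this
    split_ifs at this <;> simp_all
  · ext x
    have := h0 (liftParity (σ + 1) x)
    simp only [heightFn, coordParity_liftParity, tail_liftParity] at this
    split_ifs at this <;> simp_all

lemma exists_heightFn_of_mem_HomFi {f : (Fin (n + 1) → Bool) → ℤ} (hf : f ∈ HomFi (n + 1) 4) :
    ∃ (σ : ZMod 2) (A B : Finset (Fin n → Bool)), (A, B) ∈ separatedPairs (ballOne (n := n)) ∧
      A.Nonempty ∧ B.Nonempty ∧
      (fun u => heightFn σ A B u - heightFn σ A B fun _ => false) = f := by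
  obtain ⟨hf, hcard⟩ := hf
  obtain ⟨u₀, hmin⟩ := Finite.exists_min f
  obtain ⟨u₁, hmax⟩ := Finite.exists_max f
  have hrange : Set.range f = (Finset.Icc (f u₀) (f u₁) : Set ℤ) := by
    ext k
    simp only [Set.mem_range, coe_Icc, Set.mem_Icc]
    constructor
    · rintro ⟨u, rfl⟩
      exact ⟨hmin u, hmax u⟩
    · rintro ⟨h0, h1⟩
      exact exists_eq_of_mem_Icc hf u₀ u₁ k h0 h1
  rw [hrange, Set.ncard_coe_finset, Int.card_Icc] at hcard
  have h3 : f u₁ = f u₀ + 3 := by omega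
  have hpar : ∀ u, coordParity u = coordParity u₀ ↔ (2 : ℤ) ∣ f u - f u₀ := by
    intro u
    rw [← sub_eq_zero, ← intCast_sub_eq_coordParity_sub hf, ZMod.intCast_zmod_eq_zero_iff_dvd]
    rfl
  set σ := coordParity u₀ with hσ
  have hone : ∀ τ : ZMod 2, τ ≠ σ → τ = σ + 1 := by
    intro τ
    generalize σ = ρ
    revert τ ρ
    decide
  set A := univ.filter fun y : Fin n → Bool => f (liftParity σ y) = f u₀ with hA
  set B := univ.filter fun y : Fin n → Bool => f (liftParity (σ + 1) y) = f u₀ + 3 with hB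
  have hheight : ∀ u, heightFn σ A B u = f u - f u₀ := by
    intro u
    have h4 := hmin u
    have h5 := hmax u
    by_cases hu : coordParity u = σ
    · have h6 : Fin.tail u ∈ A ↔ f u = f u₀ := by
        rw [hA, mem_filter, ← hu, liftParity_coordParity]
        simp
      have h7 := (hpar u).1 hu
      rw [heightFn, if_pos hu]
      by_cases hfu : f u = f u₀
      · rw [if_pos (h6.2 hfu)]; omega
      · rw [if_neg (mt h6.1 hfu)]; omega
    · have h6 : Fin.tail u ∈ B ↔ f u = f u₀ + 3 := by
        rw [hB, mem_filter, ← hone _ hu, liftParity_coordParity]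
        simp
      have h7 := mt (hpar u).2 hu
      rw [heightFn, if_neg hu]
      by_cases hfu : f u = f u₀ + 3
      · rw [if_pos (h6.2 hfu)]; omega
      · rw [if_neg (mt h6.1 hfu)]; omega
  refine ⟨σ, A, B, ?_, ?_, ?_, ?_⟩
  · rw [mem_separatedPairs, disjoint_left]
    intro y hy hyB
    obtain ⟨x, hx, hxy⟩ := mem_biUnion.1 hy
    have hadj : cubeAdj (n + 1) (liftParity σ x) (liftParity (σ + 1) y) := by
      rw [cubeAdj_iff, coordParity_liftParity, coordParity_liftParity, tail_liftParity,
        tail_liftParity]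
      exact ⟨by simp, hxy⟩
    have := hf.2 _ _ hadj
    rw [(mem_filter.1 hx).2, (mem_filter.1 hyB).2] at this
    norm_num at this
  · have := hheight u₀
    rw [sub_self, heightFn_eq_zero] at this
    exact ⟨_, this.2⟩
  · have := hheight u₁
    rw [h3, add_sub_cancel_left, heightFn_eq_three] at this
    exact ⟨_, this.2⟩
  · ext u
    rw [hheight, hheight, hf.1]
    ring

theorem ncard_HomFi_four (n : ℕ) :
    ((HomFi (n + 1) 4).ncard : ℝ) =
      2 * ((separatedPairs (ballOne (n := n))).card - 2 * 2 ^ 2 ^ n + 1) := by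
  set S := separatedPairs (ballOne (n := n))
  set Q := S.filter fun p => p.1.Nonempty ∧ p.2.Nonempty with hQ
  set T : Finset (ZMod 2 × Finset (Fin n → Bool) × Finset (Fin n → Bool)) := univ ×ˢ Q with hT
  have himage : HomFi (n + 1) 4 =
      (fun q : ZMod 2 × Finset (Fin n → Bool) × Finset (Fin n → Bool) =>
        fun u => heightFn q.1 q.2.1 q.2.2 u - heightFn q.1 q.2.1 q.2.2 fun _ => false) ''
      (T : Set (ZMod 2 × Finset (Fin n → Bool) × Finset (Fin n → Bool))) := by
    ext f
    simp only [Set.mem_image, mem_coe, hT, mem_product, mem_univ, true_and]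
    constructor
    · intro hf
      obtain ⟨σ, A, B, hS, hA, hB, rfl⟩ := exists_heightFn_of_mem_HomFi hf
      exact ⟨(σ, A, B), mem_filter.2 ⟨hS, hA, hB⟩, rfl⟩
    · rintro ⟨⟨σ, A, B⟩, hq, rfl⟩
      obtain ⟨hS, hA, hB⟩ := mem_filter.1 hq
      exact mem_HomFi_heightFn hS hA hB
  have hcard : (HomFi (n + 1) 4).ncard = 2 * Q.card := by
    rw [himage, Set.InjOn.ncard_image, Set.ncard_coe_finset, hT, card_product, card_univ,
      ZMod.card]
    rintro ⟨σ, A, B⟩ h1 ⟨τ, A', B'⟩ h2 h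
    simp only [mem_coe, hT, mem_product, mem_univ, true_and, hQ, mem_filter] at h1 h2
    obtain ⟨rfl, rfl, rfl⟩ := heightFn_injective h1.2.1 h2.2.1 h
    rfl
  have hfst : (S.filter fun p => p.1 = ∅).card = 2 ^ 2 ^ n := by
    have : S.filter (fun p => p.1 = ∅) = univ.image fun B => (∅, B) := by
      ext ⟨A, B⟩
      simp only [mem_filter, S, mem_separatedPairs, mem_image, mem_univ, true_and, Prod.mk.injEq]
      constructor
      · rintro ⟨_, rfl⟩; exact ⟨B, rfl, rfl⟩
      · rintro ⟨_, rfl, rfl⟩; simp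
    rw [this, card_image_of_injective _ (Prod.mk_right_injective _)]
    simp
  have hsnd : (S.filter fun p => p.2 = ∅).card = 2 ^ 2 ^ n := by
    rw [← hfst]
    exact card_filter_separatedPairs_snd mem_ballOne_symm fun A => A = ∅
  have hboth : (S.filter (fun p => p.1 = ∅) ∩ S.filter fun p => p.2 = ∅).card = 1 := by
    rw [card_eq_one]
    refine ⟨(∅, ∅), ?_⟩
    ext ⟨A, B⟩
    simp only [mem_inter, mem_filter, S, mem_separatedPairs, mem_singleton, Prod.mk.injEq]
    constructor
    · rintro ⟨⟨_, rfl⟩, _, rfl⟩; exact ⟨rfl, rfl⟩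
    · rintro ⟨rfl, rfl⟩; simp
  have hsplit : Q.card + (S.filter (fun p => p.1 = ∅) ∪ S.filter fun p => p.2 = ∅).card =
      S.card := by
    rw [← filter_or, hQ, ← card_filter_add_card_filter_not (s := S)
      fun p => p.1.Nonempty ∧ p.2.Nonempty]
    congr 2
    refine filter_congr fun p _ => ?_
    rw [not_and_or, not_nonempty_iff_eq_empty, not_nonempty_iff_eq_empty]
  have hunion := card_union_add_card_inter (S.filter fun p => p.1 = ∅) (S.filter fun p => p.2 = ∅)
  rw [hfst, hsnd, hboth] at hunion
  have e : Q.card + 2 ^ 2 ^ n + 2 ^ 2 ^ n = S.card + 1 := by omega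
  have e' : (Q.card : ℝ) + 2 ^ 2 ^ n + 2 ^ 2 ^ n = S.card + 1 := by exact_mod_cast e
  rw [hcard]
  push_cast
  linarith

end Reduction

theorem count_homF4 :
    ∃ c > (0:ℝ), ∃ d₀ : ℕ, ∀ d : ℕ, d₀ ≤ d →
      |((HomFi d 4).ncard : ℝ) - (4 * Real.sqrt (Real.exp 1) - 4) * 2 ^ 2 ^ (d - 1)| ≤
        Real.exp (-c * d) * 2 ^ 2 ^ (d - 1) := by
  obtain ⟨d₀, h₀⟩ := Filter.eventually_atTop.1 ((eventually_card_separatedPairs.and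
    eventually_exp_sq_le).and (Filter.eventually_ge_atTop 1))
  refine ⟨1 / 12, by norm_num, d₀, fun d hd => ?_⟩
  obtain ⟨⟨h1, h2⟩, h3⟩ := h₀ d hd
  have hcount := ncard_HomFi_four (d - 1)
  rw [Nat.sub_add_cancel h3] at hcount
  rw [hcount, ← Real.exp_half, show -(1 / 12 : ℝ) * d = -(d / 12) by ring]
  have h4 : (1 : ℝ) ≤ Real.exp (2 * d ^ 2 + 2) := Real.one_le_exp (by positivity)
  rw [abs_le] at h1 ⊢
  constructor <;> linarith [h1.1, h1.2]
end
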